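/- Let p ∈ [2,∞). Suppose there exist finite constants 𝒯 and 𝒯* such that Λ_Q(φ_Q, g) ≤ 𝒯 ‖φ_Q‖_{L^p(σ;ℓ²)} ‖g‖_{L^{p'}(ω)} and Λ_Q(f, 1_Q) ≤ 𝒯* ‖f‖_{L^p(σ;ℓ²)} ω(Q)^{1/p'} hold for every Q ∈ 𝒟, every nonnegative σ×η-measurable function f, and every nonnegative Borel function g. Then there is a constant C_p depending only on p such that Λ(f,g) ≤ C_p (𝒯 + 𝒯*) ‖f‖_{L^p(σ;ℓ²)} ‖g‖_{L^{p'}(ω)} for all nonnegative σ×η-measurable f and nonnegative Borel g. -/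

import Mathlib

open MeasureTheory ENNReal Set
open scoped Classical NNReal ENNReal

noncomputable section

/-- The index of a dyadic cube `2^{-k}([0,1)^n + m)` of the standard dyadic lattice `𝒟`. -/
abbrev CubeIdx (n : ℕ) := ℤ × (Fin n → ℤ)

/-- The dyadic cube `2^{-k}([0,1)^n + m)`. -/
def dyadicCube (n : ℕ) (k : ℤ) (m : Fin n → ℤ) : Set (Fin n → ℝ) :=
  {x | ∀ i, x i ∈ Set.Ico ((2:ℝ) ^ (-k) * (m i : ℝ)) ((2:ℝ) ^ (-k) * ((m i : ℝ) + 1))}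

/-- The dyadic cube associated to an index. -/
def idxCube (n : ℕ) (Q : CubeIdx n) : Set (Fin n → ℝ) := dyadicCube n Q.1 Q.2

/-- The Carleson box `Q̂ = Q × (0, ℓ(Q)]`, where `ℓ(Q) = 2^{-k}`. -/
def carlesonBox (n : ℕ) (k : ℤ) (m : Fin n → ℤ) : Set ((Fin n → ℝ) × ℝ) :=
  (dyadicCube n k m) ×ˢ (Set.Ioc (0:ℝ) ((2:ℝ) ^ (-k)))

/-- The vertical `ℓ²`-norm `|f|_{ℓ²}(x) = (∑_{k ∈ ℤ} f(x, 2^{-k})²)^{1/2}`. -/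
def vertL2 (n : ℕ) (f : (Fin n → ℝ) × ℝ → ℝ≥0∞) (x : Fin n → ℝ) : ℝ≥0∞ :=
  (∑' k : ℤ, (f (x, (2:ℝ) ^ (-k))) ^ 2) ^ (1/2 : ℝ)

/-- The mixed norm `‖f‖_{L^q(σ; ℓ²)} = (∫ |f|_{ℓ²}^q dσ)^{1/q}`. -/
def mixedNorm (n : ℕ) (σ : Measure (Fin n → ℝ)) (q : ℝ)
    (f : (Fin n → ℝ) × ℝ → ℝ≥0∞) : ℝ≥0∞ :=
  (∫⁻ x, (vertL2 n f x) ^ q ∂σ) ^ (1/q)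

/-- The norm `‖g‖_{L^q(ω)} = (∫ g^q dω)^{1/q}` of a nonnegative function. -/
def lpNorm (n : ℕ) (ω : Measure (Fin n → ℝ)) (q : ℝ) (g : (Fin n → ℝ) → ℝ≥0∞) : ℝ≥0∞ :=
  (∫⁻ x, (g x) ^ q ∂ω) ^ (1/q)

/-- `∬_{Q̂} f μ dη dσ = ∑_{j ∈ ℤ, 2^j ≤ ℓ(Q)} ∫_Q f(x, 2^j) μ(x, 2^j) dσ(x)`. -/
def boxInt (n : ℕ) (σ : Measure (Fin n → ℝ)) (μ : (Fin n → ℝ) × ℝ → ℝ≥0∞)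
    (f : (Fin n → ℝ) × ℝ → ℝ≥0∞) (k : ℤ) (m : Fin n → ℤ) : ℝ≥0∞ :=
  ∑' j : ℤ, if (2:ℝ) ^ j ≤ (2:ℝ) ^ (-k) then
      ∫⁻ x in dyadicCube n k m, f (x, (2:ℝ) ^ j) * μ (x, (2:ℝ) ^ j) ∂σ
    else 0

/-- `1_{Q̂} μ`. -/
def boxFn (n : ℕ) (μ : (Fin n → ℝ) × ℝ → ℝ≥0∞) (k : ℤ) (m : Fin n → ℤ) :
    (Fin n → ℝ) × ℝ → ℝ≥0∞ :=
  (carlesonBox n k m).indicator μ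

/-- The test function `φ_Q = |1_{Q̂} μ|_{ℓ²}^{p'-2} 1_{Q̂} μ`,
interpreted as `0` where `|1_{Q̂} μ|_{ℓ²} = 0`. -/
def testFn (n : ℕ) (p' : ℝ) (μ : (Fin n → ℝ) × ℝ → ℝ≥0∞) (k : ℤ) (m : Fin n → ℤ) :
    (Fin n → ℝ) × ℝ → ℝ≥0∞ :=
  fun z => if vertL2 n (boxFn n μ k m) z.1 = 0 then 0
    else (vertL2 n (boxFn n μ k m) z.1) ^ (p' - 2) * boxFn n μ k m z

/-- The bilinear form `Λ(f,g) = ∑_{Q ∈ 𝒟} λ_Q (∬_{Q̂} f μ dη dσ) (∫_Q g dω)`. -/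
def lambdaForm (n : ℕ) (σ ω : Measure (Fin n → ℝ)) (μ : (Fin n → ℝ) × ℝ → ℝ≥0∞)
    (lam : CubeIdx n → ℝ≥0) (f : (Fin n → ℝ) × ℝ → ℝ≥0∞) (g : (Fin n → ℝ) → ℝ≥0∞) :
    ℝ≥0∞ :=
  ∑' Q : CubeIdx n,
    (lam Q : ℝ≥0∞) * boxInt n σ μ f Q.1 Q.2 * ∫⁻ x in idxCube n Q, g x ∂ω

/-- The localized bilinear form `Λ_{Q₀}(f,g)`, where the sum is restricted to
dyadic cubes `Q ⊆ Q₀`. -/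
def lambdaLoc (n : ℕ) (σ ω : Measure (Fin n → ℝ)) (μ : (Fin n → ℝ) × ℝ → ℝ≥0∞)
    (lam : CubeIdx n → ℝ≥0) (Q₀ : CubeIdx n)
    (f : (Fin n → ℝ) × ℝ → ℝ≥0∞) (g : (Fin n → ℝ) → ℝ≥0∞) : ℝ≥0∞ :=
  ∑' Q : CubeIdx n, if idxCube n Q ⊆ idxCube n Q₀ then
      (lam Q : ℝ≥0∞) * boxInt n σ μ f Q.1 Q.2 * ∫⁻ x in idxCube n Q, g x ∂ω
    else 0

/-- The average `⟨h⟩_Q^ν = ν(Q)⁻¹ ∫_Q h dν`, understood as `0` when `ν(Q) = 0`. -/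
def cubeAvg (n : ℕ) (ν : Measure (Fin n → ℝ)) (h : (Fin n → ℝ) → ℝ≥0∞)
    (k : ℤ) (m : Fin n → ℤ) : ℝ≥0∞ :=
  (∫⁻ x in dyadicCube n k m, h x ∂ν) / ν (dyadicCube n k m)


section Stopping

variable {ι : Type} [PartialOrder ι]

/-- `F` is the least element of `P` strictly above `Q`. -/
def IsStopParent (P : Finset ι) (F Q : ι) : Prop :=
  F ∈ P ∧ Q < F ∧ ∀ G ∈ P, Q < G → F ≤ G

/-- `F` is the least element of `P` above `Q`. -/
def IsStopTop (P : Finset ι) (F Q : ι) : Prop :=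
  F ∈ P ∧ Q ≤ F ∧ ∀ G ∈ P, Q ≤ G → F ≤ G

/-- The stopping children of `F` in the family `P`. -/
def stopChildren (P : Finset ι) (F : ι) : Finset ι :=
  P.filter (IsStopParent P F)

/-- A stopping family for the relation `bad`: an element is selected exactly when it is bad
relative to its parent, if it has one. -/
def IsStopFamily (bad : ι → ι → Prop) (P : Finset ι) : Prop :=
  ∀ Q, Q ∈ P ↔ ∀ F, IsStopParent P F Q → bad F Q

lemma exists_isStopFamily [Fintype ι] (bad : ι → ι → Prop) :
    ∃ P : Finset ι, IsStopFamily bad P := by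
  let step : (Q : ι) → ((F : ι) → F > Q → Prop) → Prop := fun Q ih =>
    ∀ F, ∀ h : F > Q, ih F h → (∀ G, ∀ hG : G > Q, ih G hG → F ≤ G) → bad F Q
  let chosen : ι → Prop := (wellFounded_gt (α := ι)).fix step
  have hchosen : ∀ Q, chosen Q ↔
      ∀ F, F > Q → chosen F → (∀ G, G > Q → chosen G → F ≤ G) → bad F Q := by
    intro Q
    have h := (wellFounded_gt (α := ι)).fix_eq step Q
    exact iff_of_eq h
  refine ⟨Finset.univ.filter chosen, fun Q => ?_⟩
  simp only [Finset.mem_filter, Finset.mem_univ, true_and, IsStopParent]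
  rw [hchosen]
  constructor
  · rintro h F ⟨h1, h2, h3⟩
    exact h F h2 h1 fun G hG hs => h3 G hs hG
  · intro h F h1 h2 h3
    exact h F ⟨h2, h1, fun G hs hG => h3 G hG hs⟩

lemma IsStopTop.unique {P : Finset ι} {F F' Q : ι} (h : IsStopTop P F Q)
    (h' : IsStopTop P F' Q) : F = F' :=
  le_antisymm (h.2.2 _ h'.1 h'.2.1) (h'.2.2 _ h.1 h.2.1)

lemma IsStopParent.unique {P : Finset ι} {F F' Q : ι} (h : IsStopParent P F Q)
    (h' : IsStopParent P F' Q) : F = F' :=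
  le_antisymm (h.2.2 _ h'.1 h'.2.1) (h'.2.2 _ h.1 h.2.1)

lemma mem_stopChildren {P : Finset ι} {F G : ι} :
    G ∈ stopChildren P F ↔ G ∈ P ∧ IsStopParent P F G := by
  simp [stopChildren]

/-- In a forest, the elements above a given one form a chain. -/
def IsForest (ι : Type) [PartialOrder ι] : Prop :=
  ∀ Q R S : ι, Q ≤ R → Q ≤ S → R ≤ S ∨ S ≤ R

lemma exists_isStopParent (hι : IsForest ι) {P : Finset ι} {F Q : ι} (hF : F ∈ P) (h : Q < F) :
    ∃ G, IsStopParent P G Q := by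
  obtain ⟨G, hG⟩ := Finset.exists_minimal (s := P.filter (Q < ·)) ⟨F, by simp [hF, h]⟩
  have hG1 := hG.1
  simp only [Finset.mem_filter] at hG1
  refine ⟨G, hG1.1, hG1.2, fun H hH hQ => ?_⟩
  rcases hι Q G H hG1.2.le hQ.le with h1 | h1
  · exact h1
  · exact hG.2 (by simp [hH, hQ]) h1

lemma IsStopFamily.exists_isStopTop {bad : ι → ι → Prop}
    {P : Finset ι} (hP : IsStopFamily bad P) (Q : ι) :
    ∃ F, IsStopTop P F Q ∧ (F = Q ∨ ¬ bad F Q) := by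
  by_cases hQ : Q ∈ P
  · exact ⟨Q, ⟨hQ, le_rfl, fun G _ h => h⟩, Or.inl rfl⟩
  · have h := hQ
    rw [hP] at h
    push Not at h
    obtain ⟨F, hF, hb⟩ := h
    refine ⟨F, ⟨hF.1, hF.2.1.le, fun G hG hle => hF.2.2 G hG (lt_of_le_of_ne hle ?_)⟩, Or.inr hb⟩
    rintro rfl
    exact hQ hG

lemma exists_stopChild (hι : IsForest ι) {P : Finset ι} {F G : ι} (hF : F ∈ P) (hG : G ∈ P)
    (h : G < F) : ∃ H ∈ stopChildren P F, G ≤ H := by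
  obtain ⟨H, hGH, hH⟩ := Finset.exists_le_maximal (a := G) (P.filter (· < F)) (by simp [hG, h])
  have hH1 := hH.1
  simp only [Finset.mem_filter] at hH1
  refine ⟨H, mem_stopChildren.2 ⟨hH1.1, hF, hH1.2, fun K hK hHK => ?_⟩, hGH⟩
  rcases hι H F K hH1.2.le hHK.le with h1 | h1
  · exact h1
  · rcases h1.lt_or_eq with h2 | h2
    · exact absurd (hH.2 (by simp [hK, h2]) hHK.le) (not_le_of_gt hHK)
    · exact h2.ge

lemma not_le_of_isStopTop {P : Finset ι} {F F' Q : ι} (h : IsStopTop P F Q)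
    (hc : F' ∈ stopChildren P F) : ¬ Q ≤ F' := by
  rw [mem_stopChildren] at hc
  exact fun hle => absurd (h.2.2 _ hc.1 hle) (not_le_of_gt hc.2.2.1)

lemma not_lt_of_mem_stopChildren {P : Finset ι} {F G H : ι} (hG : G ∈ stopChildren P F)
    (hH : H ∈ stopChildren P F) : ¬ G < H := by
  rw [mem_stopChildren] at hG hH
  exact fun hlt => absurd (hG.2.2.2 _ hH.1 hlt) (not_le_of_gt hH.2.2.1)

/-- Summing over all children of all elements counts each element at most once. -/
lemma sum_stopChildren_le (P : Finset ι) (v : ι → ℝ≥0∞) :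
    ∑ F ∈ P, ∑ F' ∈ stopChildren P F, v F' ≤ ∑ F ∈ P, v F := by
  simp only [stopChildren, Finset.sum_filter]
  rw [Finset.sum_comm]
  refine Finset.sum_le_sum fun G _ => ?_
  by_cases h : ∃ F, IsStopParent P F G
  · obtain ⟨F, hF⟩ := h
    rw [Finset.sum_eq_single F]
    · rw [if_pos hF]
    · intro H _ hne
      exact if_neg fun hH => hne (hH.unique hF)
    · exact fun hn => absurd hF.1 hn
  · push Not at h
    simp [h]

lemma sum_eq_sum_isStopTop [Fintype ι] {P : Finset ι} (hP : ∀ Q, ∃ F, IsStopTop P F Q)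
    (Y : ι → ℝ≥0∞) :
    ∑ Q, Y Q = ∑ F ∈ P, ∑ Q with IsStopTop P F Q, Y Q := by
  choose t ht using hP
  rw [← Finset.sum_fiberwise_of_maps_to (g := t) (t := P) (fun Q _ => (ht Q).1)]
  refine Finset.sum_congr rfl fun F _ => Finset.sum_congr ?_ fun _ _ => rfl
  ext Q
  simp only [Finset.mem_filter, Finset.mem_univ, true_and]
  exact ⟨fun h => h ▸ ht Q, fun h => (ht Q).unique h⟩

end Stopping

section Hardy

lemma exists_one_lt_rpow_mul_lt_one {r : ℝ} {θ : ℝ≥0} (hθ : θ < 1) :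
    ∃ δ : ℝ≥0, 0 < δ ∧ (1 + δ) ^ r * θ < 1 := by
  have hc : ContinuousAt (fun δ : ℝ≥0 => (1 + δ) ^ r * θ) 0 := by
    refine ContinuousAt.mul ?_ continuousAt_const
    exact (NNReal.continuousAt_rpow_const (x := 1 + 0) (Or.inl (by simp))).comp
      (f := fun δ : ℝ≥0 => 1 + δ) (by fun_prop)
  have h0 : ∀ᶠ δ : ℝ≥0 in nhds 0, (1 + δ) ^ r * θ < 1 :=
    hc.eventually (gt_mem_nhds (by simpa using hθ))
  have h1 : ∀ᶠ δ : ℝ≥0 in nhdsWithin 0 (Set.Ioi 0), (1 + δ) ^ r * θ < 1 :=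
    h0.filter_mono nhdsWithin_le_nhds
  obtain ⟨δ, h, h'⟩ := (h1.and self_mem_nhdsWithin).exists
  exact ⟨δ, h', h⟩

lemma add_rpow_le_of_pos {r : ℝ} (hr : 0 ≤ r) {δ : ℝ≥0} (hδ : 0 < δ) (a b : ℝ≥0∞) :
    (a + b) ^ r ≤ ((1 + δ : ℝ≥0) : ℝ≥0∞) ^ r * a ^ r
      + ((1 + δ⁻¹ : ℝ≥0) : ℝ≥0∞) ^ r * b ^ r := by
  rw [← ENNReal.mul_rpow_of_nonneg _ _ hr, ← ENNReal.mul_rpow_of_nonneg _ _ hr]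
  push_cast
  rcases le_total b (δ * a) with h | h
  · refine le_trans (ENNReal.rpow_le_rpow ?_ hr) le_self_add
    rw [add_mul, one_mul]
    gcongr
  · refine le_trans (ENNReal.rpow_le_rpow ?_ hr) le_add_self
    rw [add_mul, one_mul, add_comm a]
    gcongr
    calc a = (δ⁻¹ : ℝ≥0) * (δ * a) := by
          rw [← mul_assoc, ← ENNReal.coe_mul, inv_mul_cancel₀ hδ.ne']; simp
      _ ≤ _ := by gcongr

lemma le_of_le_mul_add {Z W a : ℝ≥0∞} (hZ : Z ≠ ∞) (ha : a < 1) (h : Z ≤ a * Z + W) :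
    Z ≤ (1 - a)⁻¹ * W := by
  have h1 : (1 - a) * Z ≤ W := by
    rw [ENNReal.sub_mul (fun _ _ => hZ), one_mul]
    exact tsub_le_iff_left.2 h
  have h2 : 1 - a ≠ 0 := (tsub_pos_of_lt ha).ne'
  calc Z = (1 - a)⁻¹ * ((1 - a) * Z) := by
        rw [← mul_assoc, ENNReal.inv_mul_cancel h2 (by simp), one_mul]
    _ ≤ _ := by gcongr

variable {ι : Type} [PartialOrder ι]

/-- The sum of `c` over the elements of `P` above `F`. -/
def stopSum (P : Finset ι) (c : ι → ℝ≥0∞) (F : ι) : ℝ≥0∞ :=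
  ∑ G ∈ P with F ≤ G, c G

lemma stopSum_eq_of_isStopParent {P : Finset ι} {c : ι → ℝ≥0∞} {F G : ι} (hG : G ∈ P)
    (h : IsStopParent P F G) : stopSum P c G = stopSum P c F + c G := by
  have : P.filter (G ≤ ·) = insert G (P.filter (F ≤ ·)) := by
    ext H
    simp only [Finset.mem_filter, Finset.mem_insert]
    constructor
    · rintro ⟨h1, h2⟩
      rcases h2.eq_or_lt with h3 | h3
      · exact Or.inl h3.symm
      · exact Or.inr ⟨h1, h.2.2 _ h1 h3⟩
    · rintro (rfl | ⟨h1, h2⟩)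
      · exact ⟨hG, le_rfl⟩
      · exact ⟨h1, h.2.1.le.trans h2⟩
  unfold stopSum
  rw [this, Finset.sum_insert, add_comm]
  simp only [Finset.mem_filter, not_and]
  exact fun _ => not_le_of_gt h.2.1

lemma stopSum_eq_of_forall_not {P : Finset ι} {c : ι → ℝ≥0∞} {G : ι} (hι : IsForest ι)
    (hG : G ∈ P) (h : ∀ F, ¬ IsStopParent P F G) : stopSum P c G = c G := by
  have : P.filter (G ≤ ·) = {G} := by
    ext H
    simp only [Finset.mem_filter, Finset.mem_singleton]
    constructor
    · rintro ⟨h1, h2⟩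
      rcases h2.eq_or_lt with h3 | h3
      · exact h3.symm
      · obtain ⟨F, hF⟩ := exists_isStopParent hι h1 h3
        exact absurd hF (h F)
    · rintro rfl
      exact ⟨hG, le_rfl⟩
  unfold stopSum
  rw [this, Finset.sum_singleton]

/-- A Hardy inequality on sparse trees. -/
lemma exists_hardy_const {r : ℝ} (hr : 0 < r) {θ : ℝ≥0} (hθ : θ < 1) :
    ∃ K : ℝ≥0∞, K ≠ ∞ ∧ ∀ (ι : Type) [PartialOrder ι], IsForest ι →
      ∀ (P : Finset ι) (M c : ι → ℝ≥0∞), (∀ F, M F ≠ ∞) → (∀ F, c F ≠ ∞) →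
      (∀ F ∈ P, ∑ F' ∈ stopChildren P F, M F' ≤ θ * M F) →
      ∑ F ∈ P, stopSum P c F ^ r * M F ≤ K * ∑ F ∈ P, c F ^ r * M F := by
  obtain ⟨δ, hδ, hδθ⟩ := exists_one_lt_rpow_mul_lt_one (r := r) hθ
  set a : ℝ≥0∞ := ((1 + δ : ℝ≥0) : ℝ≥0∞) ^ r with ha
  set b : ℝ≥0∞ := ((1 + δ⁻¹ : ℝ≥0) : ℝ≥0∞) ^ r with hb
  have hb1 : 1 ≤ b := ENNReal.one_le_rpow (by simp) hr
  have haθ : a * θ < 1 := by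
    rw [ha, ← ENNReal.coe_rpow_of_nonneg _ hr.le]
    exact_mod_cast hδθ
  refine ⟨(1 - a * θ)⁻¹ * b, ENNReal.mul_ne_top (ENNReal.inv_ne_top.2 (tsub_pos_of_lt haθ).ne')
    (ENNReal.rpow_ne_top_of_nonneg hr.le (by simp)), ?_⟩
  intro ι _ hι P M c hM hc hch
  have hS : ∀ F, stopSum P c F ≠ ∞ := fun F => ENNReal.sum_ne_top.2 fun G _ => hc G
  rw [mul_assoc]
  refine le_of_le_mul_add ?_ haθ ?_
  · exact ENNReal.sum_ne_top.2 fun F _ =>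
      ENNReal.mul_ne_top (ENNReal.rpow_ne_top_of_nonneg hr.le (hS F)) (hM F)
  have key : ∀ G ∈ P, stopSum P c G ^ r * M G ≤
      (∑ F ∈ P with IsStopParent P F G, a * stopSum P c F ^ r * M G) + b * (c G ^ r * M G) := by
    intro G hG
    by_cases h : ∃ F, IsStopParent P F G
    · obtain ⟨F, hF⟩ := h
      rw [stopSum_eq_of_isStopParent hG hF]
      calc _ ≤ (a * stopSum P c F ^ r + b * c G ^ r) * M G := by
            gcongr
            exact add_rpow_le_of_pos hr.le hδ _ _
        _ = a * stopSum P c F ^ r * M G + b * (c G ^ r * M G) := by ring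
        _ ≤ _ := by
            gcongr
            exact Finset.single_le_sum (f := fun F => a * stopSum P c F ^ r * M G)
              (fun _ _ => zero_le) (by simp [hF, hF.1])
    · push Not at h
      rw [stopSum_eq_of_forall_not hι hG h]
      refine le_trans ?_ le_add_self
      exact le_mul_of_one_le_left zero_le hb1
  calc _ ≤ ∑ G ∈ P, ((∑ F ∈ P with IsStopParent P F G, a * stopSum P c F ^ r * M G)
        + b * (c G ^ r * M G)) := Finset.sum_le_sum key
    _ = (∑ F ∈ P, a * stopSum P c F ^ r * ∑ G ∈ stopChildren P F, M G)
        + b * ∑ G ∈ P, c G ^ r * M G := by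
        rw [Finset.sum_add_distrib, Finset.mul_sum (a := b)]
        congr 1
        simp only [stopChildren, Finset.sum_filter, Finset.mul_sum]
        rw [Finset.sum_comm]
        refine Finset.sum_congr rfl fun F _ => Finset.sum_congr rfl fun G _ => ?_
        split_ifs <;> simp
    _ ≤ (∑ F ∈ P, a * stopSum P c F ^ r * (θ * M F)) + b * ∑ G ∈ P, c G ^ r * M G := by
        gcongr with F hF
        exact hch F hF
    _ = _ := by
        rw [Finset.mul_sum (a := a * θ)]
        congr 1
        exact Finset.sum_congr rfl fun F _ => by ring

/-- Carleson embedding along a sparse stopping family, from the dual Hardy inequality. -/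
lemma exists_carleson_const {r s : ℝ} (hrs : r.HolderConjugate s) {θ : ℝ≥0} (hθ : θ < 1) :
    ∃ K : ℝ≥0∞, K ≠ ∞ ∧ ∀ (ι : Type) [PartialOrder ι], IsForest ι →
      ∀ (P : Finset ι) (M A a : ι → ℝ≥0∞) (N : ℝ≥0∞), (∀ F, M F ≠ ∞) → (∀ F, A F ≠ ∞) →
      (∀ F, A F * M F = a F) →
      (∀ F ∈ P, ∑ F' ∈ stopChildren P F, M F' ≤ θ * M F) →
      (∀ c : ι → ℝ≥0∞, ∑ F ∈ P, c F * a F ≤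
        N ^ (1 / r) * (∑ F ∈ P, stopSum P c F ^ s * M F) ^ (1 / s)) →
      ∑ F ∈ P, A F ^ r * M F ≤ K * N := by
  obtain ⟨K, hK, hhardy⟩ := exists_hardy_const hrs.symm.pos hθ
  refine ⟨K ^ (r - 1), ENNReal.rpow_ne_top_of_nonneg (by linarith [hrs.lt]) hK, ?_⟩
  intro ι _ hι P M A a N hM hA haM hch hdual
  set Z := ∑ F ∈ P, A F ^ r * M F with hZ
  have hr := hrs.pos
  have hs := hrs.symm.pos
  have hr1 : 0 ≤ r - 1 := by linarith [hrs.lt]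
  have hZtop : Z ≠ ∞ := ENNReal.sum_ne_top.2 fun F _ =>
    ENNReal.mul_ne_top (ENNReal.rpow_ne_top_of_nonneg hr.le (hA F)) (hM F)
  have e1 : ∑ F ∈ P, A F ^ (r - 1) * a F = Z := by
    refine Finset.sum_congr rfl fun F _ => ?_
    rw [← haM, ← mul_assoc]
    congr 1
    calc A F ^ (r - 1) * A F = A F ^ (r - 1) * A F ^ (1 : ℝ) := by rw [ENNReal.rpow_one]
      _ = A F ^ r := by
        rw [← ENNReal.rpow_add_of_nonneg _ _ hr1 zero_le_one]; congr 1; ring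
  have e2 : ∑ F ∈ P, (A F ^ (r - 1)) ^ s * M F = Z := by
    refine Finset.sum_congr rfl fun F _ => ?_
    rw [← ENNReal.rpow_mul, hrs.sub_one_mul_conj]
  have h := hdual fun F => A F ^ (r - 1)
  have h2 := hhardy ι hι P M (fun F => A F ^ (r - 1)) hM
    (fun F => ENNReal.rpow_ne_top_of_nonneg hr1 (hA F)) hch
  rw [e1] at h
  rw [e2] at h2
  have h3 : Z ≤ N ^ (1 / r) * (K * Z) ^ (1 / s) := h.trans (by gcongr)
  have h4 : Z ^ r ≤ N * (K ^ (r - 1) * Z ^ (r - 1)) := by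
    calc Z ^ r ≤ (N ^ (1 / r) * (K * Z) ^ (1 / s)) ^ r := by gcongr
      _ = N * (K ^ (r - 1) * Z ^ (r - 1)) := by
        rw [ENNReal.mul_rpow_of_nonneg _ _ hr.le, ← ENNReal.rpow_mul, ← ENNReal.rpow_mul,
          one_div_mul_cancel hr.ne', ENNReal.rpow_one, one_div_mul_eq_div,
          hrs.div_conj_eq_sub_one, ENNReal.mul_rpow_of_nonneg _ _ hr1]
  rcases eq_or_ne Z 0 with h0 | h0
  · rw [h0]; exact zero_le
  have h5 : Z ^ r = Z * Z ^ (r - 1) := by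
    calc Z ^ r = Z ^ (1 + (r - 1)) := by congr 1; ring
      _ = Z * Z ^ (r - 1) := by
        rw [ENNReal.rpow_add _ _ h0 hZtop, ENNReal.rpow_one]
  rw [h5, ← mul_assoc, mul_comm N] at h4
  exact (ENNReal.mul_le_mul_iff_left (by simp [ENNReal.rpow_eq_zero_iff, h0, hZtop])
    (ENNReal.rpow_ne_top_of_nonneg hr1 hZtop)).1 h4

end Hardy

section StoppingAverages

variable {ι : Type} [PartialOrder ι]

/-- The stopping rule: `Q` is bad relative to `F` when `a Q` exceeds twice the amount predicted
by the average of `a` over `F`. -/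
def badPair (a M : ι → ℝ≥0∞) (m : ι → ι → ℝ≥0∞) (F Q : ι) : Prop :=
  2 * (a F / M F) * m F Q < a Q

lemma two_mul_sum_stopChildren_le {a M : ι → ℝ≥0∞} {m : ι → ι → ℝ≥0∞} {P : Finset ι}
    (hP : IsStopFamily (badPair a M m) P) {F : ι}
    (hA : a F / M F ≠ ∞) (haM : a F / M F * M F = a F)
    (hsub : ∑ F' ∈ stopChildren P F, a F' ≤ a F) :
    2 * ∑ F' ∈ stopChildren P F, m F F' ≤ M F := by
  have hbad : ∀ F' ∈ stopChildren P F, 2 * (a F / M F) * m F F' < a F' := by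
    intro F' hF'
    rw [mem_stopChildren] at hF'
    exact (hP F').1 hF'.1 F hF'.2
  have h1 : (a F / M F) * (2 * ∑ F' ∈ stopChildren P F, m F F') ≤ (a F / M F) * M F := by
    calc _ = ∑ F' ∈ stopChildren P F, 2 * (a F / M F) * m F F' := by
          rw [← mul_assoc, Finset.mul_sum, mul_comm _ (2 : ℝ≥0∞)]
      _ ≤ ∑ F' ∈ stopChildren P F, a F' := Finset.sum_le_sum fun F' h => (hbad F' h).le
      _ ≤ a F := hsub
      _ = _ := haM.symm
  rcases eq_or_ne (a F / M F) 0 with h0 | h0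
  · have ha : a F = 0 := by rw [← haM, h0, zero_mul]
    rw [ha] at hsub
    have hemp : stopChildren P F = ∅ := by
      rw [Finset.eq_empty_iff_forall_notMem]
      intro F' hF'
      have h2 := (Finset.sum_eq_zero_iff.1 (le_zero_iff.1 hsub)) F' hF'
      have h3 := hbad F' hF'
      rw [h2] at h3
      exact ENNReal.not_lt_zero h3
    simp [hemp]
  · exact (ENNReal.mul_le_mul_iff_right h0 hA).1 h1

/-- Carleson embedding for the stopping family generated by the averages `a / M`. -/
lemma exists_stopping_carleson_const {r s : ℝ} (hrs : r.HolderConjugate s) {θ : ℝ≥0}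
    (hθ : θ < 1) :
    ∃ K : ℝ≥0∞, K ≠ ∞ ∧ ∀ (ι : Type) [PartialOrder ι], IsForest ι →
      ∀ (M a : ι → ℝ≥0∞) (m : ι → ι → ℝ≥0∞) (N : ℝ≥0∞), N ≠ ∞ → (∀ F, M F ≠ ∞) →
      (∀ (P : Finset ι) (c : ι → ℝ≥0∞), ∑ F ∈ P, c F * a F ≤
        N ^ (1 / r) * (∑ F ∈ P, stopSum P c F ^ s * M F) ^ (1 / s)) →
      (∀ (P : Finset ι), ∀ F ∈ P, ∑ F' ∈ stopChildren P F, a F' ≤ a F) →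
      (∀ (P : Finset ι), ∀ F ∈ P, 2 * ∑ F' ∈ stopChildren P F, m F F' ≤ M F →
        ∑ F' ∈ stopChildren P F, M F' ≤ θ * M F) →
      (∀ F, a F / M F * M F = a F) ∧
      ∀ P : Finset ι, IsStopFamily (badPair a M m) P →
        ∑ F ∈ P, (a F / M F) ^ r * M F ≤ K * N := by
  obtain ⟨K, hK, hcar⟩ := exists_carleson_const hrs hθ
  refine ⟨K, hK, ?_⟩
  intro ι _ hι M a m N hN hM hdual hsub hsparse
  have hr := hrs.pos
  have hs := hrs.symm.pos
  have hsingle : ∀ F, a F ≤ N ^ (1 / r) * M F ^ (1 / s) := by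
    intro F
    have h := hdual {F} fun _ => 1
    have hS : stopSum {F} (fun _ => (1 : ℝ≥0∞)) F = 1 := by
      simp [stopSum, Finset.filter_singleton]
    simpa [hS] using h
  have ha : ∀ F, a F ≠ ∞ := fun F => ne_top_of_le_ne_top
    (ENNReal.mul_ne_top (ENNReal.rpow_ne_top_of_nonneg (by positivity) hN)
      (ENNReal.rpow_ne_top_of_nonneg (by positivity) (hM F))) (hsingle F)
  have ha0 : ∀ F, M F = 0 → a F = 0 := by
    intro F h0
    have h := hsingle F
    rw [h0, ENNReal.zero_rpow_of_pos (by positivity), mul_zero] at h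
    exact le_zero_iff.1 h
  have hA : ∀ F, a F / M F ≠ ∞ := by
    intro F
    rcases eq_or_ne (M F) 0 with h0 | h0
    · simp [ha0 F h0]
    · exact ENNReal.div_ne_top (ha F) h0
  have haM : ∀ F, a F / M F * M F = a F := by
    intro F
    rcases eq_or_ne (M F) 0 with h0 | h0
    · simp [ha0 F h0]
    · exact ENNReal.div_mul_cancel h0 (hM F)
  refine ⟨haM, fun P hP => ?_⟩
  exact hcar ι hι P M (fun F => a F / M F) a N hM hA haM
    (fun F hF => hsparse P F hF (two_mul_sum_stopChildren_le hP (hA F) (haM F)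
      (hsub P F hF))) (hdual P)

lemma mul_le_rpow_add_rpow {r s : ℝ} (hrs : r.HolderConjugate s) (x y : ℝ≥0∞) :
    x * y ≤ x ^ r + y ^ s := by
  refine (ENNReal.young_inequality x y hrs).trans (add_le_add ?_ ?_)
  · exact ENNReal.div_le_of_le_mul (le_mul_of_one_le_right zero_le
      (by simpa using hrs.lt.le))
  · exact ENNReal.div_le_of_le_mul (le_mul_of_one_le_right zero_le
      (by simpa using hrs.symm.lt.le))

/-- Summation over the stopping family of the localized testing estimates. -/
lemma sum_le_of_stopFamily [Fintype ι] {r s : ℝ} (hrs : r.HolderConjugate s)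
    {a b M y l : ι → ℝ≥0∞} {m β : ι → ι → ℝ≥0∞} {P : Finset ι} {T K L : ℝ≥0∞}
    (hP : IsStopFamily (badPair a M m) P)
    (haM : ∀ F, a F / M F * M F = a F) (hmM : ∀ F, m F F = M F)
    (hβ : ∀ F Q, IsStopTop P F Q → b Q ≤ β F Q)
    (htest : ∀ F ∈ P, ∑ Q with Q ≤ F, l Q * m F Q * β F Q ≤ T * M F ^ (1 / r) * y F)
    (hK : ∑ F ∈ P, (a F / M F) ^ r * M F ≤ K) (hL : ∑ F ∈ P, y F ^ s ≤ L) :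
    ∑ Q, l Q * a Q * b Q ≤ 2 * T * (K + L) := by
  have hr := hrs.pos
  have htop : ∀ Q, ∃ F, IsStopTop P F Q := fun Q =>
    let ⟨F, hF, _⟩ := hP.exists_isStopTop Q; ⟨F, hF⟩
  have hgood : ∀ F Q, IsStopTop P F Q → a Q ≤ 2 * (a F / M F) * m F Q := by
    intro F Q h
    obtain ⟨F', hF', h'⟩ := hP.exists_isStopTop Q
    obtain rfl := h.unique hF'
    rcases h' with rfl | h'
    · rw [hmM, mul_assoc, haM, two_mul]
      exact le_self_add
    · exact not_lt.1 h'
  rw [sum_eq_sum_isStopTop htop]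
  calc _ ≤ ∑ F ∈ P, 2 * T * (((a F / M F) ^ r * M F) + y F ^ s) := by
        refine Finset.sum_le_sum fun F hF => ?_
        calc _ ≤ ∑ Q with IsStopTop P F Q, 2 * (a F / M F) * (l Q * m F Q * β F Q) := by
              refine Finset.sum_le_sum fun Q hQ => ?_
              have hQ' : IsStopTop P F Q := by simpa using hQ
              calc _ ≤ l Q * (2 * (a F / M F) * m F Q) * β F Q := by
                    gcongr
                    · exact hgood F Q hQ'
                    · exact hβ F Q hQ'
                _ = _ := by ring
          _ ≤ ∑ Q with Q ≤ F, 2 * (a F / M F) * (l Q * m F Q * β F Q) := by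
              refine Finset.sum_le_sum_of_subset fun Q hQ => ?_
              simp only [Finset.mem_filter, Finset.mem_univ, true_and] at hQ ⊢
              exact hQ.2.1
          _ = 2 * (a F / M F) * ∑ Q with Q ≤ F, (l Q * m F Q * β F Q) := by
              rw [Finset.mul_sum]
          _ ≤ 2 * (a F / M F) * (T * M F ^ (1 / r) * y F) := by
              gcongr
              exact htest F hF
          _ = 2 * T * (((a F / M F) * M F ^ (1 / r)) * y F) := by ring
          _ ≤ 2 * T * (((a F / M F) * M F ^ (1 / r)) ^ r + y F ^ s) := by
              gcongr
              exact mul_le_rpow_add_rpow hrs _ _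
          _ = _ := by
              rw [ENNReal.mul_rpow_of_nonneg _ _ hr.le, ← ENNReal.rpow_mul,
                one_div_mul_cancel hr.ne', ENNReal.rpow_one]
    _ = 2 * T * (∑ F ∈ P, (a F / M F) ^ r * M F + ∑ F ∈ P, y F ^ s) := by
        rw [← Finset.mul_sum, Finset.sum_add_distrib]
    _ ≤ _ := by gcongr

end StoppingAverages

section Nested

variable {ι Z : Type} [PartialOrder ι] [MeasurableSpace Z]

/-- A family of measurable sets, indexed monotonically by `ι`, in which two sets that meet have
comparable indices. -/
structure IsNested (s : ι → Set Z) : Prop where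
  measurableSet : ∀ Q, MeasurableSet (s Q)
  mono : ∀ {Q R}, Q ≤ R → s Q ⊆ s R
  comparable : ∀ {z Q R}, z ∈ s Q → z ∈ s R → Q ≤ R ∨ R ≤ Q

lemma IsNested.pairwiseDisjoint_stopChildren {s : ι → Set Z} (hs : IsNested s) (P : Finset ι)
    (F : ι) : (↑(stopChildren P F) : Set ι).PairwiseDisjoint s := by
  intro G hG H hH hne
  rw [Function.onFun, Set.disjoint_left]
  intro z hzG hzH
  rcases hs.comparable hzG hzH with h | h
  · exact not_lt_of_mem_stopChildren hG hH (lt_of_le_of_ne h hne)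
  · exact not_lt_of_mem_stopChildren hH hG (lt_of_le_of_ne h hne.symm)

lemma IsNested.sum_setLIntegral_stopChildren_le {s : ι → Set Z} (hs : IsNested s)
    (P : Finset ι) (F : ι) (ν : Measure Z) (h : Z → ℝ≥0∞) :
    ∑ F' ∈ stopChildren P F, ∫⁻ z in s F', h z ∂ν ≤ ∫⁻ z in s F, h z ∂ν := by
  rw [← lintegral_biUnion_finset (hs.pairwiseDisjoint_stopChildren P F)
    (fun Q _ => hs.measurableSet Q)]
  refine lintegral_mono_set (Set.iUnion₂_subset fun F' hF' => hs.mono ?_)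
  exact (mem_stopChildren.1 hF').2.2.1.le

/-- The part of `s F` outside the stopping children of `F`. -/
def stopRemainder (s : ι → Set Z) (P : Finset ι) (F : ι) : Set Z :=
  s F \ ⋃ F' ∈ stopChildren P F, s F'

lemma IsNested.measurableSet_stopRemainder {s : ι → Set Z} (hs : IsNested s) (P : Finset ι)
    (F : ι) : MeasurableSet (stopRemainder s P F) :=
  (hs.measurableSet F).diff (Finset.measurableSet_biUnion _ fun Q _ => hs.measurableSet Q)

lemma IsNested.pairwiseDisjoint_stopRemainder (hι : IsForest ι) {s : ι → Set Z}
    (hs : IsNested s) (P : Finset ι) :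
    (↑P : Set ι).PairwiseDisjoint (stopRemainder s P) := by
  have key : ∀ F ∈ P, ∀ G ∈ P, F < G → ∀ z ∈ stopRemainder s P F, z ∉ stopRemainder s P G := by
    intro F hF G hG hlt z hzF hzG
    obtain ⟨H, hH, hFH⟩ := exists_stopChild hι hG hF hlt
    exact hzG.2 (Set.mem_iUnion₂.2 ⟨H, hH, hs.mono hFH hzF.1⟩)
  intro F hF G hG hne
  rw [Function.onFun, Set.disjoint_left]
  intro z hzF hzG
  rcases hs.comparable hzF.1 hzG.1 with h | h
  · exact key F hF G hG (lt_of_le_of_ne h hne) z hzF hzG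
  · exact key G hG F hF (lt_of_le_of_ne h hne.symm) z hzG hzF

/-- Replacing a function on the stopping children of `F` by functions with the same integrals
does not decrease its integrals over sets whose stopping ancestor is `F`. -/
lemma IsNested.setLIntegral_le_of_isStopTop {s : ι → Set Z}
    (hs : IsNested s) {P : Finset ι} {F Q : ι} (hQ : IsStopTop P F Q) (ν : Measure Z)
    {h : Z → ℝ≥0∞} (hh : Measurable h) {k : ι → Z → ℝ≥0∞} (hk : ∀ G, Measurable (k G))
    (hint : ∀ G, ∫⁻ z in s G, k G z ∂ν = ∫⁻ z in s G, h z ∂ν) :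
    ∫⁻ z in s Q, h z ∂ν ≤ ∫⁻ z in s Q, ((stopRemainder s P F).indicator h z
      + ∑ G ∈ stopChildren P F, (s G).indicator (k G) z) ∂ν := by
  have hsub : s Q ⊆ (s Q ∩ stopRemainder s P F) ∪
      ⋃ G ∈ (stopChildren P F).filter (· ≤ Q), s G := by
    intro z hz
    by_cases hzE : z ∈ stopRemainder s P F
    · exact Or.inl ⟨hz, hzE⟩
    · right
      have : z ∈ ⋃ G ∈ stopChildren P F, s G := by
        by_contra hn
        exact hzE ⟨hs.mono hQ.2.1 hz, hn⟩
      obtain ⟨G, hG, hzG⟩ := Set.mem_iUnion₂.1 this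
      refine Set.mem_iUnion₂.2 ⟨G, ?_, hzG⟩
      rcases hs.comparable hzG hz with hle | hle
      · exact Finset.mem_filter.2 ⟨hG, hle⟩
      · exact absurd hle (not_le_of_isStopTop hQ hG)
  have hE := hs.measurableSet_stopRemainder P F
  calc ∫⁻ z in s Q, h z ∂ν
      ≤ ∫⁻ z in (s Q ∩ stopRemainder s P F) ∪
          ⋃ G ∈ (stopChildren P F).filter (· ≤ Q), s G, h z ∂ν := lintegral_mono_set hsub
    _ ≤ ∫⁻ z in s Q ∩ stopRemainder s P F, h z ∂ν
          + ∫⁻ z in ⋃ G ∈ (stopChildren P F).filter (· ≤ Q), s G, h z ∂ν :=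
        lintegral_union_le _ _ _
    _ = ∫⁻ z in s Q ∩ stopRemainder s P F, h z ∂ν
          + ∑ G ∈ stopChildren P F with G ≤ Q, ∫⁻ z in s G, h z ∂ν := by
        rw [lintegral_biUnion_finset _ fun Q _ => hs.measurableSet Q]
        exact (hs.pairwiseDisjoint_stopChildren P F).subset
          (Finset.coe_subset.2 (Finset.filter_subset _ _))
    _ ≤ ∫⁻ z in s Q, (stopRemainder s P F).indicator h z ∂ν
          + ∑ G ∈ stopChildren P F, ∫⁻ z in s Q, (s G).indicator (k G) z ∂ν := by
        gcongr ?_ + ?_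
        · rw [setLIntegral_indicator hE, Set.inter_comm]
        · rw [Finset.sum_filter]
          refine Finset.sum_le_sum fun G _ => ?_
          split_ifs with hle
          · rw [setLIntegral_indicator (hs.measurableSet G),
              Set.inter_eq_left.2 (hs.mono hle), hint]
          · exact zero_le
    _ = _ := by
        rw [← lintegral_finsetSum _ fun G _ => (hk G).indicator (hs.measurableSet G),
          ← lintegral_add_left (hh.indicator hE)]

/-- The superposition of weights at a point is controlled by the stopping sums. -/
lemma IsNested.rpow_sum_indicator_le {s : ι → Set Z} (hs : IsNested s) (P : Finset ι)
    (c : ι → ℝ≥0∞) {r : ℝ} (hr : 0 < r) (z : Z) :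
    (∑ F ∈ P, (s F).indicator (fun _ => c F) z) ^ r ≤
      ∑ F ∈ P, (s F).indicator (fun _ => stopSum P c F ^ r) z := by
  by_cases hne : (P.filter (z ∈ s ·)).Nonempty
  · obtain ⟨F, hF⟩ := Finset.exists_minimal hne
    have hF1 := hF.1
    simp only [Finset.mem_filter] at hF1
    have h1 : ∑ G ∈ P, (s G).indicator (fun _ => c G) z ≤ stopSum P c F := by
      unfold stopSum
      rw [Finset.sum_filter]
      refine Finset.sum_le_sum fun G hG => ?_
      by_cases hz : z ∈ s G
      · have hle : F ≤ G := by
          rcases hs.comparable hF1.2 hz with h | h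
          · exact h
          · exact hF.2 (by simp [hG, hz]) h
        simp [hz, hle]
      · simp [hz]
    calc _ ≤ stopSum P c F ^ r := by gcongr
      _ = (s F).indicator (fun _ => stopSum P c F ^ r) z := by simp [hF1.2]
      _ ≤ _ := Finset.single_le_sum
          (f := fun F => (s F).indicator (fun _ => stopSum P c F ^ r) z)
          (fun _ _ => zero_le) hF1.1
  · rw [Finset.not_nonempty_iff_eq_empty, Finset.filter_eq_empty_iff] at hne
    have : ∑ G ∈ P, (s G).indicator (fun _ => c G) z = 0 :=
      Finset.sum_eq_zero fun G hG => Set.indicator_of_notMem (hne hG) _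
    rw [this, ENNReal.zero_rpow_of_pos hr]
    exact zero_le

end Nested

section PowerSums

lemma rpow_finsetSum_le {α : Type*} (t : Finset α) (x : α → ℝ≥0∞) {r : ℝ} (hr : 0 < r)
    (hr1 : r ≤ 1) : (∑ i ∈ t, x i) ^ r ≤ ∑ i ∈ t, x i ^ r := by
  induction t using Finset.induction_on with
  | empty => simp [hr]
  | insert i t hi ih =>
    rw [Finset.sum_insert hi, Finset.sum_insert hi]
    exact (ENNReal.rpow_add_le_add_rpow _ _ hr.le hr1).trans (by gcongr)

lemma finsetSum_rpow_le {α : Type*} (t : Finset α) (x : α → ℝ≥0∞) {r : ℝ} (hr1 : 1 ≤ r) :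
    ∑ i ∈ t, x i ^ r ≤ (∑ i ∈ t, x i) ^ r := by
  induction t using Finset.induction_on with
  | empty => simp
  | insert i t hi ih =>
    rw [Finset.sum_insert hi, Finset.sum_insert hi]
    exact le_trans (by gcongr) (ENNReal.add_rpow_le_rpow_add _ _ hr1)

lemma add_rpow_le_two_rpow_mul {r : ℝ} (hr : 0 ≤ r) (x y : ℝ≥0∞) :
    (x + y) ^ r ≤ 2 ^ r * (x ^ r + y ^ r) := by
  have h : x + y ≤ 2 * max x y := by
    rw [two_mul]
    exact add_le_add (le_max_left _ _) (le_max_right _ _)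
  calc (x + y) ^ r ≤ (2 * max x y) ^ r := by gcongr
    _ = 2 ^ r * (max x y) ^ r := ENNReal.mul_rpow_of_nonneg _ _ hr
    _ ≤ _ := by
      gcongr
      rcases le_total x y with h | h
      · rw [max_eq_right h]; exact le_add_self
      · rw [max_eq_left h]; exact le_self_add

/-- Powers commute with sums of functions having pairwise disjoint supports. -/
lemma rpow_sum_of_pairwiseDisjoint {ι Z : Type*} {s : ι → Set Z} {t : Finset ι}
    (ht : (↑t : Set ι).PairwiseDisjoint s) {u : ι → Z → ℝ≥0∞}
    (hu : ∀ i, ∀ z ∉ s i, u i z = 0) {r : ℝ} (hr : 0 < r) (z : Z) :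
    (∑ i ∈ t, u i z) ^ r = ∑ i ∈ t, u i z ^ r := by
  by_cases h : ∃ i ∈ t, z ∈ s i
  · obtain ⟨i, hi, hz⟩ := h
    have h0 : ∀ j ∈ t, j ≠ i → u j z = 0 := fun j hj hne =>
      hu j z fun hzj => Set.disjoint_left.1 (ht hj hi hne) hzj hz
    rw [Finset.sum_eq_single i h0 (fun hn => absurd hi hn),
      Finset.sum_eq_single i (fun j hj hne => by rw [h0 j hj hne, ENNReal.zero_rpow_of_pos hr])
        (fun hn => absurd hi hn)]
  · push Not at h
    rw [Finset.sum_eq_zero fun i hi => hu i z (h i hi), ENNReal.zero_rpow_of_pos hr,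
      Finset.sum_eq_zero fun i hi => by rw [hu i z (h i hi), ENNReal.zero_rpow_of_pos hr]]

lemma sum_indicator_le_of_pairwiseDisjoint {ι Z : Type*} {s : ι → Set Z} {t : Finset ι}
    (ht : (↑t : Set ι).PairwiseDisjoint s) (h : Z → ℝ≥0∞) (z : Z) :
    ∑ i ∈ t, (s i).indicator h z ≤ h z := by
  by_cases hex : ∃ i ∈ t, z ∈ s i
  · obtain ⟨i, hi, hz⟩ := hex
    rw [Finset.sum_eq_single i (fun j hj hne => Set.indicator_of_notMem
      (fun hzj => Set.disjoint_left.1 (ht hj hi hne) hzj hz) _) (fun hn => absurd hi hn),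
      Set.indicator_of_mem hz]
  · push Not at hex
    rw [Finset.sum_eq_zero fun i hi => Set.indicator_of_notMem (hex i hi) _]
    exact zero_le

end PowerSums

section Scalar

variable {ι X : Type} [PartialOrder ι] [MeasurableSpace X]

lemma IsNested.sum_mul_setLIntegral_le {s : ι → Set X} (hs : IsNested s) (ω : Measure X)
    {r r' : ℝ} (hr : r.HolderConjugate r') {g : X → ℝ≥0∞} (hg : Measurable g) (P : Finset ι)
    (c : ι → ℝ≥0∞) :
    ∑ F ∈ P, c F * ∫⁻ x in s F, g x ∂ω ≤ (∫⁻ x, g x ^ r ∂ω) ^ (1 / r) *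
      (∑ F ∈ P, stopSum P c F ^ r' * ω (s F)) ^ (1 / r') := by
  have hr'0 := hr.symm.pos
  have hu : ∀ F, Measurable ((s F).indicator fun _ => c F) := fun F =>
    measurable_const.indicator (hs.measurableSet F)
  calc ∑ F ∈ P, c F * ∫⁻ x in s F, g x ∂ω
      = ∫⁻ x, (g * fun x => ∑ F ∈ P, (s F).indicator (fun _ => c F) x) x ∂ω := by
        simp only [Pi.mul_apply, Finset.mul_sum]
        rw [lintegral_finsetSum _ fun F _ => hg.fun_mul (hu F)]
        refine Finset.sum_congr rfl fun F _ => ?_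
        rw [← lintegral_const_mul _ hg, ← lintegral_indicator (hs.measurableSet F)]
        refine lintegral_congr fun x => ?_
        by_cases hx : x ∈ s F <;> simp [hx, mul_comm]
    _ ≤ (∫⁻ x, g x ^ r ∂ω) ^ (1 / r) *
        (∫⁻ x, (∑ F ∈ P, (s F).indicator (fun _ => c F) x) ^ r' ∂ω) ^ (1 / r') :=
        ENNReal.lintegral_mul_le_Lp_mul_Lq ω hr hg.aemeasurable
          (Finset.measurable_fun_sum P fun F _ => hu F).aemeasurable
    _ ≤ _ := by
        gcongr
        calc _ ≤ ∫⁻ x, ∑ F ∈ P, (s F).indicator (fun _ => stopSum P c F ^ r') x ∂ω :=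
              lintegral_mono fun x => hs.rpow_sum_indicator_le P c hr'0 x
          _ = _ := by
              rw [lintegral_finsetSum _ fun F _ =>
                measurable_const.indicator (hs.measurableSet F)]
              refine Finset.sum_congr rfl fun F _ => ?_
              rw [lintegral_indicator_const (hs.measurableSet F)]

/-- The function `g` with its values on the stopping children of `F` replaced by constants. -/
def scalarPiece (s : ι → Set X) (P : Finset ι) (B : ι → ℝ≥0∞) (g : X → ℝ≥0∞) (F : ι) (x : X) :
    ℝ≥0∞ :=
  (stopRemainder s P F).indicator g x + ∑ G ∈ stopChildren P F, (s G).indicator (fun _ => B G) x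

lemma IsNested.measurable_scalarPiece {s : ι → Set X} (hs : IsNested s) (P : Finset ι)
    (B : ι → ℝ≥0∞) {g : X → ℝ≥0∞} (hg : Measurable g) (F : ι) :
    Measurable (scalarPiece s P B g F) :=
  (hg.indicator (hs.measurableSet_stopRemainder P F)).add
    (Finset.measurable_fun_sum _ fun G _ => measurable_const.indicator (hs.measurableSet G))

lemma IsNested.sum_lintegral_scalarPiece_rpow_le (hι : IsForest ι) {s : ι → Set X}
    (hs : IsNested s) (P : Finset ι) (B : ι → ℝ≥0∞) {g : X → ℝ≥0∞} (hg : Measurable g)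
    (ω : Measure X) {r : ℝ} (hr : 0 < r) :
    ∑ F ∈ P, ∫⁻ x, scalarPiece s P B g F x ^ r ∂ω ≤
      2 ^ r * (∫⁻ x, g x ^ r ∂ω + ∑ F ∈ P, B F ^ r * ω (s F)) := by
  have hgr : Measurable fun x => g x ^ r := hg.pow_const r
  have hE := hs.measurableSet_stopRemainder P
  have hpt : ∀ F x, scalarPiece s P B g F x ^ r ≤
      2 ^ r * ((stopRemainder s P F).indicator (fun x => g x ^ r) x
        + ∑ G ∈ stopChildren P F, (s G).indicator (fun _ => B G ^ r) x) := by
    intro F x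
    refine (add_rpow_le_two_rpow_mul hr.le _ _).trans ?_
    gcongr
    · by_cases hx : x ∈ stopRemainder s P F <;> simp [hx, hr]
    · rw [rpow_sum_of_pairwiseDisjoint (hs.pairwiseDisjoint_stopChildren P F)
        (fun G z hz => Set.indicator_of_notMem hz _) hr]
      refine Finset.sum_le_sum fun G _ => ?_
      by_cases hx : x ∈ s G <;> simp [hx, hr]
  calc _ ≤ ∑ F ∈ P, 2 ^ r * (∫⁻ x, (stopRemainder s P F).indicator (fun x => g x ^ r) x ∂ω
        + ∑ G ∈ stopChildren P F, B G ^ r * ω (s G)) := by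
        refine Finset.sum_le_sum fun F _ => (lintegral_mono (hpt F)).trans (le_of_eq ?_)
        have hm : ∀ G ∈ stopChildren P F, Measurable ((s G).indicator fun _ => B G ^ r) :=
          fun G _ => measurable_const.indicator (hs.measurableSet G)
        rw [lintegral_const_mul _ ((hgr.indicator (hE F)).fun_add (Finset.measurable_fun_sum _ hm)),
          lintegral_add_left (hgr.indicator (hE F)), lintegral_finsetSum _ hm]
        congr 2
        exact Finset.sum_congr rfl fun G _ => lintegral_indicator_const (hs.measurableSet G) _
    _ = 2 ^ r * (∫⁻ x, ∑ F ∈ P, (stopRemainder s P F).indicator (fun x => g x ^ r) x ∂ω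
        + ∑ F ∈ P, ∑ G ∈ stopChildren P F, B G ^ r * ω (s G)) := by
        rw [← Finset.mul_sum, Finset.sum_add_distrib,
          lintegral_finsetSum _ fun F _ => hgr.indicator (hE F)]
    _ ≤ _ := by
        gcongr 2 ^ r * (?_ + ?_)
        · refine lintegral_mono fun x => ?_
          exact sum_indicator_le_of_pairwiseDisjoint
            (hs.pairwiseDisjoint_stopRemainder hι P) (fun x => g x ^ r) _
        · exact sum_stopChildren_le P fun F => B F ^ r * ω (s F)

end Scalar

section MixedNorm

variable {X : Type}

/-- The vertical square sum of a function on `X × ℤ`. -/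
def sqSum (f : X × ℤ → ℝ≥0∞) (x : X) : ℝ≥0∞ := ∑' k : ℤ, f (x, k) ^ 2

lemma sqSum_mono {f h : X × ℤ → ℝ≥0∞} {x : X} (hfh : ∀ k, f (x, k) ≤ h (x, k)) :
    sqSum f x ≤ sqSum h x :=
  ENNReal.tsum_le_tsum fun k => by gcongr; exact hfh k

variable [MeasurableSpace X]

/-- The `r`-th power of the mixed norm of a function on `X × ℤ`. -/
def mixedPow (σ : Measure X) (r : ℝ) (f : X × ℤ → ℝ≥0∞) : ℝ≥0∞ :=
  ∫⁻ x, sqSum f x ^ (r / 2) ∂σ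

lemma measurable_sqSum {f : X × ℤ → ℝ≥0∞} (hf : Measurable f) : Measurable (sqSum f) :=
  Measurable.tsum fun k => by fun_prop

lemma lintegral_prod_count (σ : Measure X) {h : X × ℤ → ℝ≥0∞} (hh : Measurable h) :
    ∫⁻ z, h z ∂(σ.prod Measure.count) = ∫⁻ x, ∑' k : ℤ, h (x, k) ∂σ := by
  rw [lintegral_prod _ hh.aemeasurable]
  exact lintegral_congr fun x => lintegral_count _

lemma tsum_mul_le_sqrt_mul_sqrt (a b : ℤ → ℝ≥0∞) :
    ∑' k, a k * b k ≤ (∑' k, a k ^ 2) ^ (1 / 2 : ℝ) * (∑' k, b k ^ 2) ^ (1 / 2 : ℝ) := by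
  have h := ENNReal.lintegral_mul_le_Lp_mul_Lq (Measure.count : Measure ℤ)
    (p := 2) (q := 2) Real.HolderConjugate.two_two
    (f := a) (g := b) (by fun_prop) (by fun_prop)
  simpa [lintegral_count] using h

lemma lintegral_mul_le_mixedPow {p q : ℝ} (hpq : p.HolderConjugate q) (σ : Measure X)
    {f h : X × ℤ → ℝ≥0∞} (hf : Measurable f) (hh : Measurable h) :
    ∫⁻ z, f z * h z ∂(σ.prod Measure.count) ≤
      mixedPow σ p f ^ (1 / p) * mixedPow σ q h ^ (1 / q) := by
  rw [lintegral_prod_count σ (hf.fun_mul hh)]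
  calc _ ≤ ∫⁻ x, ((fun x => sqSum f x ^ (1 / 2 : ℝ)) * fun x => sqSum h x ^ (1 / 2 : ℝ)) x ∂σ :=
        lintegral_mono fun x => tsum_mul_le_sqrt_mul_sqrt _ _
    _ ≤ _ := ENNReal.lintegral_mul_le_Lp_mul_Lq σ hpq
        ((measurable_sqSum hf).pow_const _).aemeasurable
        ((measurable_sqSum hh).pow_const _).aemeasurable
    _ = _ := by
        simp only [← ENNReal.rpow_mul, mixedPow, one_div_mul_eq_div]

lemma rpow_sub_one_mul_self {v : ℝ≥0∞} (hv : v ≠ ∞) {s : ℝ} (hs : 0 < s) :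
    v ^ (s - 1) * v = v ^ s := by
  rcases eq_or_ne v 0 with rfl | h0
  · simp [hs]
  · calc v ^ (s - 1) * v = v ^ (s - 1) * v ^ (1 : ℝ) := by rw [ENNReal.rpow_one]
      _ = v ^ s := by rw [← ENNReal.rpow_add _ _ h0 hv]; congr 1; ring

/-- A linearized form of the concavity of `t ↦ t ^ s` at `t = 1 / 2`. -/
lemma two_rpow_mul_rpow_le {u v : ℝ≥0∞} (huv : u ≤ v) (hv : v ≠ ∞) {s : ℝ≥0} (hs : 0 < s)
    (hs1 : s ≤ 1) :
    2 ^ (s : ℝ) * u ^ (s : ℝ) ≤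
      s * (2 * (v ^ ((s : ℝ) - 1) * u)) + ((1 - s : ℝ≥0) : ℝ≥0∞) * v ^ (s : ℝ) := by
  have hs' : (0 : ℝ) < s := hs
  rcases eq_or_ne v 0 with rfl | h0
  · have : u = 0 := le_zero_iff.1 huv
    simp [this, hs']
  lift v to ℝ≥0 using hv
  lift u to ℝ≥0 using ne_top_of_le_ne_top ENNReal.coe_ne_top huv
  have h0' : v ≠ 0 := by exact_mod_cast h0
  have key := NNReal.geom_mean_le_arith_mean2_weighted s (1 - s) (2 * (u / v)) 1
    (add_tsub_cancel_of_le hs1)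
  rw [NNReal.one_rpow, mul_one, mul_one] at key
  have h1 : 2 ^ (s : ℝ) * u ^ (s : ℝ) = (2 * (u / v)) ^ (s : ℝ) * v ^ (s : ℝ) := by
    rw [← NNReal.mul_rpow, ← NNReal.mul_rpow, mul_assoc, div_mul_cancel₀ _ h0']
  have h2 : v ^ ((s : ℝ) - 1) * u = (u / v) * v ^ (s : ℝ) := by
    rw [NNReal.rpow_sub h0', NNReal.rpow_one]
    field_simp
  have key2 : 2 ^ (s : ℝ) * u ^ (s : ℝ) ≤
      s * (2 * (v ^ ((s : ℝ) - 1) * u)) + (1 - s) * v ^ (s : ℝ) := by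
    rw [h1, h2]
    calc _ ≤ (s * (2 * (u / v)) + (1 - s)) * v ^ (s : ℝ) := by gcongr
      _ = _ := by ring
  rw [← ENNReal.coe_rpow_of_ne_zero h0', ← ENNReal.coe_rpow_of_nonneg _ hs'.le,
    ← ENNReal.coe_rpow_of_nonneg _ hs'.le]
  have h2c : (2 : ℝ≥0∞) ^ (s : ℝ) = ((2 ^ (s : ℝ) : ℝ≥0) : ℝ≥0∞) := by
    rw [ENNReal.coe_rpow_of_nonneg _ hs'.le]; rfl
  rw [h2c]
  exact_mod_cast key2

end MixedNorm

section Boxes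

variable {ι X : Type}

/-- The discrete Carleson boxes over a family of cubes with given levels. -/
def levelBox (cube : ι → Set X) (lev : ι → ℤ) (Q : ι) : Set (X × ℤ) :=
  cube Q ×ˢ Set.Ici (lev Q)

variable (cube : ι → Set X) (lev : ι → ℤ) (μ : X × ℤ → ℝ≥0∞)

/-- The square sum of the weight restricted to the box over `Q`. -/
def boxSq (Q : ι) (x : X) : ℝ≥0∞ := sqSum ((levelBox cube lev Q).indicator μ) x

/-- The test function associated with the box over `F`. -/
def boxTest (q : ℝ) (F : ι) (z : X × ℤ) : ℝ≥0∞ :=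
  boxSq cube lev μ F z.1 ^ (q / 2 - 1) * (levelBox cube lev F).indicator μ z

variable {cube lev μ}

lemma boxSq_of_notMem {Q : ι} {x : X} (hx : x ∉ cube Q) : boxSq cube lev μ Q x = 0 := by
  simp [boxSq, sqSum, levelBox, hx]

lemma boxTest_of_notMem {q : ℝ} {F : ι} {z : X × ℤ} (hz : z ∉ levelBox cube lev F) :
    boxTest cube lev μ q F z = 0 := by
  simp [boxTest, hz]

lemma sqSum_boxTest (q : ℝ) (F : ι) (x : X) :
    sqSum (boxTest cube lev μ q F) x =
      (boxSq cube lev μ F x ^ (q / 2 - 1)) ^ 2 * boxSq cube lev μ F x := by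
  simp only [sqSum, boxTest, mul_pow, ENNReal.tsum_mul_left]
  rfl

variable [MeasurableSpace X]

variable (cube lev μ) in
/-- The integral of `f μ` over the box over `Q`. -/
def boxPairing (σ : Measure X) (f : X × ℤ → ℝ≥0∞) (Q : ι) : ℝ≥0∞ :=
  ∫⁻ z in levelBox cube lev Q, f z * μ z ∂(σ.prod Measure.count)

variable (cube lev μ) in
/-- The mass `∫ |1_Q̂ μ| ^ q`. -/
def boxMass (σ : Measure X) (q : ℝ) (Q : ι) : ℝ≥0∞ :=
  ∫⁻ x, boxSq cube lev μ Q x ^ (q / 2) ∂σ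

variable [PartialOrder ι]

lemma IsNested.levelBox {cube : ι → Set X} (hc : IsNested cube) {lev : ι → ℤ}
    (hlev : Antitone lev) : IsNested (levelBox cube lev) where
  measurableSet Q := (hc.measurableSet Q).prod measurableSet_Ici
  mono h := Set.prod_mono (hc.mono h) (Set.Ici_subset_Ici.2 (hlev h))
  comparable h h' := hc.comparable h.1 h'.1

lemma measurable_boxSq (hc : IsNested cube) (hlev : Antitone lev) (hμ : Measurable μ) (Q : ι) :
    Measurable (boxSq cube lev μ Q) :=
  measurable_sqSum (hμ.indicator ((hc.levelBox hlev).measurableSet Q))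

lemma boxSq_mono (hc : IsNested cube) (hlev : Antitone lev) {Q R : ι} (h : Q ≤ R) (x : X) :
    boxSq cube lev μ Q x ≤ boxSq cube lev μ R x :=
  sqSum_mono fun _ => Set.indicator_le_indicator_of_subset ((hc.levelBox hlev).mono h)
    (fun _ => zero_le) _

lemma measurable_boxTest (hc : IsNested cube) (hlev : Antitone lev) (hμ : Measurable μ) (q : ℝ)
    (F : ι) : Measurable (boxTest cube lev μ q F) :=
  (((measurable_boxSq hc hlev hμ F).comp measurable_fst).pow_const _).mul
    (hμ.indicator ((hc.levelBox hlev).measurableSet F))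

lemma boxPairing_boxTest (hc : IsNested cube) (hlev : Antitone lev) (hμ : Measurable μ)
    (σ : Measure X) (q : ℝ) {F Q : ι} (h : Q ≤ F) :
    boxPairing cube lev μ σ (boxTest cube lev μ q F) Q =
      ∫⁻ x, boxSq cube lev μ F x ^ (q / 2 - 1) * boxSq cube lev μ Q x ∂σ := by
  have hb := hc.levelBox hlev
  unfold boxPairing
  rw [← lintegral_indicator (hb.measurableSet Q),
    lintegral_prod_count σ (((measurable_boxTest hc hlev hμ q F).fun_mul hμ).indicator
      (hb.measurableSet Q))]
  refine lintegral_congr fun x => ?_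
  rw [boxSq, boxSq, sqSum, sqSum, ← ENNReal.tsum_mul_left]
  refine tsum_congr fun k => ?_
  by_cases hz : (x, k) ∈ levelBox cube lev Q
  · have hz' := hb.mono h hz
    simp only [Set.indicator_of_mem hz, Set.indicator_of_mem hz', boxTest, boxSq, sqSum]
    ring
  · simp [hz]

lemma ae_boxSq_ne_top (hc : IsNested cube) (hlev : Antitone lev) (hμ : Measurable μ)
    {σ : Measure X} {q : ℝ} (hq : 0 < q) {F : ι} (hM : boxMass cube lev μ σ q F ≠ ∞) :
    ∀ᵐ x ∂σ, boxSq cube lev μ F x ≠ ∞ := by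
  have h := ae_lt_top ((measurable_boxSq hc hlev hμ F).pow_const (q / 2)) hM
  filter_upwards [h] with x hx htop
  rw [htop, ENNReal.top_rpow_of_pos (by positivity)] at hx
  exact lt_irrefl _ hx

lemma boxPairing_boxTest_self (hc : IsNested cube) (hlev : Antitone lev) (hμ : Measurable μ)
    {σ : Measure X} {q : ℝ} (hq : 0 < q) {F : ι} (hM : boxMass cube lev μ σ q F ≠ ∞) :
    boxPairing cube lev μ σ (boxTest cube lev μ q F) F = boxMass cube lev μ σ q F := by
  rw [boxPairing_boxTest hc hlev hμ σ q le_rfl]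
  refine lintegral_congr_ae ?_
  filter_upwards [ae_boxSq_ne_top hc hlev hμ hq hM] with x hx
  exact rpow_sub_one_mul_self hx (by positivity)

lemma mixedPow_boxTest (hc : IsNested cube) (hlev : Antitone lev) (hμ : Measurable μ)
    {σ : Measure X} {p q : ℝ} (hpq : p.HolderConjugate q) {F : ι}
    (hM : boxMass cube lev μ σ q F ≠ ∞) :
    mixedPow σ p (boxTest cube lev μ q F) = boxMass cube lev μ σ q F := by
  have hp := hpq.pos
  have hq := hpq.symm.pos
  refine lintegral_congr_ae ?_
  filter_upwards [ae_boxSq_ne_top hc hlev hμ hq hM] with x hx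
  rw [sqSum_boxTest]
  rcases eq_or_ne (boxSq cube lev μ F x) 0 with h0 | h0
  · rw [h0, mul_zero, ENNReal.zero_rpow_of_pos (by positivity),
      ENNReal.zero_rpow_of_pos (by positivity)]
  · have e : (boxSq cube lev μ F x ^ (q / 2 - 1)) ^ 2 * boxSq cube lev μ F x
        = boxSq cube lev μ F x ^ (q - 1) := by
      rw [← ENNReal.rpow_natCast, ← ENNReal.rpow_mul]
      calc _ = boxSq cube lev μ F x ^ ((q / 2 - 1) * ((2 : ℕ) : ℝ))
            * boxSq cube lev μ F x ^ (1 : ℝ) := by rw [ENNReal.rpow_one]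
        _ = _ := by
            rw [← ENNReal.rpow_add _ _ h0 hx]; congr 1; push_cast; ring
    rw [e, ← ENNReal.rpow_mul]
    congr 1
    have := hpq.symm.sub_one_mul_conj
    linear_combination this / 2

lemma sum_mul_boxPairing_le (hc : IsNested cube) (hlev : Antitone lev) (hμ : Measurable μ)
    (σ : Measure X) {p q : ℝ} (hpq : p.HolderConjugate q) (hq2 : q ≤ 2) {f : X × ℤ → ℝ≥0∞}
    (hf : Measurable f) (P : Finset ι) (c : ι → ℝ≥0∞) :
    ∑ F ∈ P, c F * boxPairing cube lev μ σ f F ≤ mixedPow σ p f ^ (1 / p) *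
      (∑ F ∈ P, stopSum P c F ^ q * boxMass cube lev μ σ q F) ^ (1 / q) := by
  have hb := hc.levelBox hlev
  have hq := hpq.symm.pos
  have hind : ∀ F, Measurable ((levelBox cube lev F).indicator fun _ => c F) := fun F =>
    measurable_const.indicator (hb.measurableSet F)
  set u : X × ℤ → ℝ≥0∞ := fun z => ∑ F ∈ P, (levelBox cube lev F).indicator (fun _ => c F) z
    with hu
  have hum : Measurable u := Finset.measurable_fun_sum P fun F _ => hind F
  have hsq : ∀ x, sqSum (fun z => u z * μ z) x ≤
      ∑ F ∈ P, stopSum P c F ^ (2 : ℝ) * boxSq cube lev μ F x := by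
    intro x
    calc sqSum (fun z => u z * μ z) x
        ≤ ∑' k : ℤ, ∑ F ∈ P, stopSum P c F ^ (2 : ℝ)
            * (levelBox cube lev F).indicator μ (x, k) ^ 2 := by
          refine ENNReal.tsum_le_tsum fun k => ?_
          rw [mul_pow]
          have h := hb.rpow_sum_indicator_le P c (r := 2) two_pos (x, k)
          rw [ENNReal.rpow_two] at h
          calc _ ≤ (∑ F ∈ P, (levelBox cube lev F).indicator
                  (fun _ => stopSum P c F ^ (2 : ℝ)) (x, k)) * μ (x, k) ^ 2 := by
                gcongr
            _ = _ := by
                rw [Finset.sum_mul]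
                refine Finset.sum_congr rfl fun F _ => ?_
                by_cases hz : (x, k) ∈ levelBox cube lev F <;> simp [hz]
      _ = _ := by
          rw [Summable.tsum_finsetSum fun _ _ => ENNReal.summable]
          refine Finset.sum_congr rfl fun F _ => ?_
          rw [ENNReal.tsum_mul_left]
          rfl
  calc _ = ∫⁻ z, f z * (u z * μ z) ∂(σ.prod Measure.count) := by
        simp only [hu, Finset.sum_mul, Finset.mul_sum]
        rw [lintegral_finsetSum _ fun F _ => hf.fun_mul ((hind F).fun_mul hμ)]
        refine Finset.sum_congr rfl fun F _ => ?_
        unfold boxPairing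
        rw [← lintegral_const_mul _ (hf.fun_mul hμ), ← lintegral_indicator (hb.measurableSet F)]
        refine lintegral_congr fun z => ?_
        by_cases hz : z ∈ levelBox cube lev F
        · simp only [Set.indicator_of_mem hz]; ring
        · simp [hz]
    _ ≤ mixedPow σ p f ^ (1 / p) * mixedPow σ q (fun z => u z * μ z) ^ (1 / q) :=
        lintegral_mul_le_mixedPow hpq σ hf (hum.fun_mul hμ)
    _ ≤ _ := by
        gcongr
        calc mixedPow σ q (fun z => u z * μ z)
            ≤ ∫⁻ x, ∑ F ∈ P, stopSum P c F ^ q * boxSq cube lev μ F x ^ (q / 2) ∂σ := by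
              refine lintegral_mono fun x => ?_
              calc _ ≤ (∑ F ∈ P, stopSum P c F ^ (2 : ℝ) * boxSq cube lev μ F x) ^ (q / 2) := by
                    gcongr
                    exact hsq x
                _ ≤ ∑ F ∈ P, (stopSum P c F ^ (2 : ℝ) * boxSq cube lev μ F x) ^ (q / 2) :=
                    rpow_finsetSum_le _ _ (by positivity) (by linarith)
                _ = _ := by
                    refine Finset.sum_congr rfl fun F _ => ?_
                    rw [ENNReal.mul_rpow_of_nonneg _ _ (by positivity), ← ENNReal.rpow_mul]
                    congr 2
                    ring
          _ = _ := by
              rw [lintegral_finsetSum _ fun F _ =>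
                ((measurable_boxSq hc hlev hμ F).pow_const _).const_mul _]
              refine Finset.sum_congr rfl fun F _ => ?_
              rw [lintegral_const_mul _ ((measurable_boxSq hc hlev hμ F).pow_const _)]
              rfl

/-- Sparseness with respect to the pairing with a test function passes to the masses. -/
lemma sum_boxMass_stopChildren_le (hc : IsNested cube) (hlev : Antitone lev) (hμ : Measurable μ)
    {σ : Measure X} {s : ℝ≥0} (hs : 0 < s) (hs1 : s ≤ 1)
    {F : ι} (hM : boxMass cube lev μ σ (2 * s) F ≠ ∞) (P : Finset ι)
    (h : 2 * ∑ F' ∈ stopChildren P F,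
      boxPairing cube lev μ σ (boxTest cube lev μ (2 * s) F) F' ≤ boxMass cube lev μ σ (2 * s) F) :
    ∑ F' ∈ stopChildren P F, boxMass cube lev μ σ (2 * s) F' ≤
      (((2 : ℝ≥0) ^ (s : ℝ))⁻¹ : ℝ≥0) * boxMass cube lev μ σ (2 * s) F := by
  have hs' : (0 : ℝ) < s := hs
  have e : 2 * (s : ℝ) / 2 = s := by ring
  have hvm := measurable_boxSq (μ := μ) hc hlev hμ
  set M := boxMass cube lev μ σ (2 * s) F with hMdef
  have hmain : ∀ F' ∈ stopChildren P F,
      2 ^ (s : ℝ) * boxMass cube lev μ σ (2 * s) F' ≤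
        s * (2 * boxPairing cube lev μ σ (boxTest cube lev μ (2 * s) F) F')
        + ((1 - s : ℝ≥0) : ℝ≥0∞) * ∫⁻ x in cube F', boxSq cube lev μ F x ^ (s : ℝ) ∂σ := by
    intro F' hF'
    have hle : F' ≤ F := (mem_stopChildren.1 hF').2.2.1.le
    rw [boxPairing_boxTest hc hlev hμ σ _ hle, boxMass, e,
      ← lintegral_indicator (hc.measurableSet F'),
      ← lintegral_const_mul _ ((hvm F').pow_const _),
      ← lintegral_const_mul _ (((hvm F).pow_const _).fun_mul (hvm F')),
      ← lintegral_const_mul _ ((((hvm F).pow_const _).fun_mul (hvm F')).const_mul _),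
      ← lintegral_const_mul _ (((hvm F).pow_const _).indicator (hc.measurableSet F')),
      ← lintegral_add_left
        (((((hvm F).pow_const _).fun_mul (hvm F')).const_mul _).const_mul _)]
    refine lintegral_mono_ae ?_
    filter_upwards [ae_boxSq_ne_top hc hlev hμ (by positivity) hM] with x hx
    by_cases hxF : x ∈ cube F'
    · rw [Set.indicator_of_mem hxF]
      exact two_rpow_mul_rpow_le (boxSq_mono hc hlev hle x) hx hs hs1
    · rw [boxSq_of_notMem hxF, ENNReal.zero_rpow_of_pos hs', mul_zero]
      exact zero_le
  have htot : 2 ^ (s : ℝ) * ∑ F' ∈ stopChildren P F, boxMass cube lev μ σ (2 * s) F' ≤ M := by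
    calc _ ≤ ∑ F' ∈ stopChildren P F,
          (s * (2 * boxPairing cube lev μ σ (boxTest cube lev μ (2 * s) F) F')
          + ((1 - s : ℝ≥0) : ℝ≥0∞) * ∫⁻ x in cube F', boxSq cube lev μ F x ^ (s : ℝ) ∂σ) := by
          rw [Finset.mul_sum]
          exact Finset.sum_le_sum hmain
      _ = s * (2 * ∑ F' ∈ stopChildren P F,
            boxPairing cube lev μ σ (boxTest cube lev μ (2 * s) F) F')
          + ((1 - s : ℝ≥0) : ℝ≥0∞) * ∑ F' ∈ stopChildren P F,
            ∫⁻ x in cube F', boxSq cube lev μ F x ^ (s : ℝ) ∂σ := by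
          rw [Finset.sum_add_distrib, ← Finset.mul_sum, ← Finset.mul_sum, ← Finset.mul_sum]
      _ ≤ s * M + ((1 - s : ℝ≥0) : ℝ≥0∞) * M := by
          gcongr
          refine (hc.sum_setLIntegral_stopChildren_le P F σ _).trans ?_
          rw [hMdef, boxMass, e]
          exact setLIntegral_le_lintegral _ _
      _ = M := by
          rw [← add_mul, ← ENNReal.coe_add, add_tsub_cancel_of_le hs1, ENNReal.coe_one, one_mul]
  have h2 : ((2 : ℝ≥0) ^ (s : ℝ)) ≠ 0 := by simp
  have h2c : (2 : ℝ≥0∞) ^ (s : ℝ) = ((2 ^ (s : ℝ) : ℝ≥0) : ℝ≥0∞) := by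
    rw [ENNReal.coe_rpow_of_nonneg _ hs'.le]; rfl
  rw [h2c] at htot
  calc ∑ F' ∈ stopChildren P F, boxMass cube lev μ σ (2 * s) F'
      = (((2 : ℝ≥0) ^ (s : ℝ))⁻¹ : ℝ≥0) * (((2 ^ (s : ℝ) : ℝ≥0) : ℝ≥0∞) *
        ∑ F' ∈ stopChildren P F, boxMass cube lev μ σ (2 * s) F') := by
        rw [← mul_assoc, ← ENNReal.coe_mul, inv_mul_cancel₀ h2, ENNReal.coe_one, one_mul]
    _ ≤ _ := by gcongr

end Boxes

section VectorPieces

variable {ι X : Type} [PartialOrder ι]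

/-- The part of `f` seen by a stopping cube `F`: `f` on the box over `F` outside the boxes of the
stopping children, replaced there by multiples of the corresponding test functions. -/
def vectorPiece (cube : ι → Set X) (lev : ι → ℤ) (μ : X × ℤ → ℝ≥0∞) (q : ℝ) (P : Finset ι)
    (A : ι → ℝ≥0∞) (f : X × ℤ → ℝ≥0∞) (F : ι) (z : X × ℤ) : ℝ≥0∞ :=
  (stopRemainder (levelBox cube lev) P F).indicator f z
    + ∑ G ∈ stopChildren P F, A G * boxTest cube lev μ q G z

variable [MeasurableSpace X] {cube : ι → Set X} {lev : ι → ℤ} {μ : X × ℤ → ℝ≥0∞}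

lemma measurable_vectorPiece (hc : IsNested cube) (hlev : Antitone lev) (hμ : Measurable μ)
    (q : ℝ) (P : Finset ι) (A : ι → ℝ≥0∞) {f : X × ℤ → ℝ≥0∞} (hf : Measurable f) (F : ι) :
    Measurable (vectorPiece cube lev μ q P A f F) :=
  (hf.indicator ((hc.levelBox hlev).measurableSet_stopRemainder P F)).add
    (Finset.measurable_fun_sum _ fun G _ => (measurable_boxTest hc hlev hμ q G).const_mul _)

lemma boxPairing_le_vectorPiece (hc : IsNested cube) (hlev : Antitone lev) (hμ : Measurable μ)
    {σ : Measure X} {q : ℝ} (hq : 0 < q) (hM : ∀ F, boxMass cube lev μ σ q F ≠ ∞)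
    {P : Finset ι} {A : ι → ℝ≥0∞} {f : X × ℤ → ℝ≥0∞} (hf : Measurable f)
    (hA : ∀ G, A G * boxMass cube lev μ σ q G = boxPairing cube lev μ σ f G)
    {F Q : ι} (hQ : IsStopTop P F Q) :
    boxPairing cube lev μ σ f Q ≤
      boxPairing cube lev μ σ (vectorPiece cube lev μ q P A f F) Q := by
  have hb := hc.levelBox hlev
  refine (hb.setLIntegral_le_of_isStopTop hQ (σ.prod Measure.count) (hf.fun_mul hμ)
    (k := fun G z => A G * (boxTest cube lev μ q G z * μ z))
    (fun G => ((measurable_boxTest hc hlev hμ q G).fun_mul hμ).const_mul _) fun G => ?_).trans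
    (le_of_eq ?_)
  · rw [lintegral_const_mul _ ((measurable_boxTest hc hlev hμ q G).fun_mul hμ)]
    exact (congrArg _ (boxPairing_boxTest_self hc hlev hμ hq (hM G))).trans (hA G)
  · refine lintegral_congr fun z => ?_
    rw [vectorPiece, add_mul, Finset.sum_mul]
    congr 1
    · by_cases hz : z ∈ stopRemainder (levelBox cube lev) P F <;> simp [hz]
    · refine Finset.sum_congr rfl fun G _ => ?_
      by_cases hz : z ∈ levelBox cube lev G
      · rw [Set.indicator_of_mem hz, mul_assoc]
      · rw [Set.indicator_of_notMem hz, boxTest_of_notMem hz, mul_zero, zero_mul]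

lemma sqSum_vectorPiece_rpow_le (hc : IsNested cube) (hlev : Antitone lev) {p : ℝ} (hp : 0 < p)
    (q : ℝ) (P : Finset ι) (A : ι → ℝ≥0∞) (f : X × ℤ → ℝ≥0∞) (F : ι) (x : X) :
    sqSum (vectorPiece cube lev μ q P A f F) x ^ (p / 2) ≤ 8 ^ (p / 2) *
      (sqSum ((stopRemainder (levelBox cube lev) P F).indicator f) x ^ (p / 2)
        + ∑ G ∈ stopChildren P F, A G ^ p * sqSum (boxTest cube lev μ q G) x ^ (p / 2)) := by
  have hb := hc.levelBox hlev
  have hsq : sqSum (vectorPiece cube lev μ q P A f F) x ≤ 4 *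
      (sqSum ((stopRemainder (levelBox cube lev) P F).indicator f) x
        + ∑ G ∈ stopChildren P F, A G ^ (2 : ℝ) * sqSum (boxTest cube lev μ q G) x) := by
    calc _ ≤ ∑' k : ℤ, 4 * ((stopRemainder (levelBox cube lev) P F).indicator f (x, k) ^ 2
          + ∑ G ∈ stopChildren P F, A G ^ (2 : ℝ) * boxTest cube lev μ q G (x, k) ^ 2) := by
          refine ENNReal.tsum_le_tsum fun k => ?_
          have h := add_rpow_le_two_rpow_mul (r := 2) two_pos.le
            ((stopRemainder (levelBox cube lev) P F).indicator f (x, k))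
            (∑ G ∈ stopChildren P F, A G * boxTest cube lev μ q G (x, k))
          rw [rpow_sum_of_pairwiseDisjoint (hb.pairwiseDisjoint_stopChildren P F)
            (u := fun G z => A G * boxTest cube lev μ q G z)
            (fun G z hz => by rw [boxTest_of_notMem hz, mul_zero]) two_pos] at h
          simp only [ENNReal.mul_rpow_of_nonneg _ _ two_pos.le, ENNReal.rpow_two] at h ⊢
          refine h.trans (le_of_eq ?_)
          norm_num
      _ = _ := by
          rw [ENNReal.tsum_mul_left, ENNReal.tsum_add,
            Summable.tsum_finsetSum fun _ _ => ENNReal.summable]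
          simp only [ENNReal.tsum_mul_left]
          rfl
  have h0 : 0 < p / 2 := by positivity
  calc _ ≤ (4 * (sqSum ((stopRemainder (levelBox cube lev) P F).indicator f) x
        + ∑ G ∈ stopChildren P F, A G ^ (2 : ℝ) * sqSum (boxTest cube lev μ q G) x)) ^ (p / 2) := by
        gcongr
    _ ≤ 4 ^ (p / 2) * (2 ^ (p / 2) *
        (sqSum ((stopRemainder (levelBox cube lev) P F).indicator f) x ^ (p / 2)
        + (∑ G ∈ stopChildren P F,
          A G ^ (2 : ℝ) * sqSum (boxTest cube lev μ q G) x) ^ (p / 2))) := by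
        rw [ENNReal.mul_rpow_of_nonneg _ _ h0.le]
        gcongr
        exact add_rpow_le_two_rpow_mul h0.le _ _
    _ = _ := by
        rw [rpow_sum_of_pairwiseDisjoint (hc.pairwiseDisjoint_stopChildren P F)
          (u := fun G x => A G ^ (2 : ℝ) * sqSum (boxTest cube lev μ q G) x)
          (fun G z hz => by rw [sqSum_boxTest, boxSq_of_notMem hz, mul_zero, mul_zero]) h0,
          ← mul_assoc, ← ENNReal.mul_rpow_of_nonneg _ _ h0.le]
        have h8 : (4 * 2 : ℝ≥0∞) = 8 := by norm_num
        have hp2 : 2 * (p / 2) = p := by ring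
        rw [h8]
        simp only [ENNReal.mul_rpow_of_nonneg _ _ h0.le, ← ENNReal.rpow_mul, hp2]

lemma sum_mixedPow_vectorPiece_le (hι : IsForest ι) (hc : IsNested cube) (hlev : Antitone lev)
    (hμ : Measurable μ) {σ : Measure X} {p q : ℝ} (hp : 2 ≤ p) (hpq : p.HolderConjugate q)
    (hM : ∀ F, boxMass cube lev μ σ q F ≠ ∞) (P : Finset ι) (A : ι → ℝ≥0∞)
    {f : X × ℤ → ℝ≥0∞} (hf : Measurable f) :
    ∑ F ∈ P, mixedPow σ p (vectorPiece cube lev μ q P A f F) ≤ 8 ^ (p / 2) *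
      (mixedPow σ p f + ∑ F ∈ P, A F ^ p * boxMass cube lev μ σ q F) := by
  have hb := hc.levelBox hlev
  have hE := hb.measurableSet_stopRemainder P
  have hm1 : ∀ F, Measurable fun x =>
      sqSum ((stopRemainder (levelBox cube lev) P F).indicator f) x ^ (p / 2) := fun F =>
    (measurable_sqSum (hf.indicator (hE F))).pow_const _
  have hm2 : ∀ F, ∀ G ∈ stopChildren P F, Measurable fun x =>
      A G ^ p * sqSum (boxTest cube lev μ q G) x ^ (p / 2) := fun F G _ =>
    ((measurable_sqSum (measurable_boxTest hc hlev hμ q G)).pow_const _).const_mul _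
  calc _ ≤ ∑ F ∈ P, 8 ^ (p / 2) *
        (∫⁻ x, sqSum ((stopRemainder (levelBox cube lev) P F).indicator f) x ^ (p / 2) ∂σ
          + ∑ G ∈ stopChildren P F, A G ^ p * boxMass cube lev μ σ q G) := by
        refine Finset.sum_le_sum fun F _ => (lintegral_mono fun x =>
          sqSum_vectorPiece_rpow_le hc hlev hpq.pos q P A f F x).trans (le_of_eq ?_)
        rw [lintegral_const_mul _ ((hm1 F).fun_add (Finset.measurable_fun_sum _ (hm2 F))),
          lintegral_add_left (hm1 F), lintegral_finsetSum _ (hm2 F)]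
        congr 2
        refine Finset.sum_congr rfl fun G _ => ?_
        rw [lintegral_const_mul _
          ((measurable_sqSum (measurable_boxTest hc hlev hμ q G)).pow_const _)]
        exact congrArg _ (mixedPow_boxTest hc hlev hμ hpq (hM G))
    _ = 8 ^ (p / 2) * (∫⁻ x, ∑ F ∈ P,
          sqSum ((stopRemainder (levelBox cube lev) P F).indicator f) x ^ (p / 2) ∂σ
        + ∑ F ∈ P, ∑ G ∈ stopChildren P F, A G ^ p * boxMass cube lev μ σ q G) := by
        rw [← Finset.mul_sum, Finset.sum_add_distrib, lintegral_finsetSum _ fun F _ => hm1 F]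
    _ ≤ _ := by
        gcongr 8 ^ (p / 2) * (?_ + ?_)
        · refine lintegral_mono fun x => (finsetSum_rpow_le _ _ (by linarith)).trans ?_
          gcongr
          simp only [sqSum]
          rw [← Summable.tsum_finsetSum fun _ _ => ENNReal.summable]
          refine ENNReal.tsum_le_tsum fun k => ?_
          refine le_trans (le_of_eq (Finset.sum_congr rfl fun F _ => ?_))
            (sum_indicator_le_of_pairwiseDisjoint
              (hb.pairwiseDisjoint_stopRemainder hι P) (fun z => f z ^ 2) (x, k))
          by_cases hz : (x, k) ∈ stopRemainder (levelBox cube lev) P F <;> simp [hz]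
        · exact sum_stopChildren_le P fun F => A F ^ p * boxMass cube lev μ σ q F

end VectorPieces

section Bilinear

lemma exists_boxPairing_carleson_const {p q : ℝ} (hp : 2 ≤ p) (hpq : p.HolderConjugate q) :
    ∃ K : ℝ≥0∞, K ≠ ∞ ∧ ∀ (ι X : Type) [PartialOrder ι] [MeasurableSpace X], IsForest ι →
      ∀ (cube : ι → Set X) (lev : ι → ℤ) (μ f : X × ℤ → ℝ≥0∞) (σ : Measure X),
      IsNested cube → Antitone lev → Measurable μ → Measurable f →
      (∀ F, boxMass cube lev μ σ q F ≠ ∞) → mixedPow σ p f ≤ 1 →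
      (∀ F, boxPairing cube lev μ σ f F / boxMass cube lev μ σ q F * boxMass cube lev μ σ q F =
        boxPairing cube lev μ σ f F) ∧
      ∀ P : Finset ι, IsStopFamily (badPair (boxPairing cube lev μ σ f) (boxMass cube lev μ σ q)
          fun F => boxPairing cube lev μ σ (boxTest cube lev μ q F)) P →
        ∑ F ∈ P, (boxPairing cube lev μ σ f F / boxMass cube lev μ σ q F) ^ p
          * boxMass cube lev μ σ q F ≤ K := by
  have hq0 := hpq.symm.pos
  have hq2 : q ≤ 2 := by
    have := hpq.symm.sub_one_mul_conj
    nlinarith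
  obtain ⟨s, hs⟩ : ∃ s : ℝ≥0, q = 2 * s := ⟨⟨q / 2, by positivity⟩, by
    change q = 2 * (q / 2); ring⟩
  have hs0 : 0 < s := by
    rw [← NNReal.coe_pos]; linarith
  have hs1 : s ≤ 1 := by
    rw [← NNReal.coe_le_coe, NNReal.coe_one]; linarith
  have hθ : ((2 : ℝ≥0) ^ (s : ℝ))⁻¹ < 1 :=
    inv_lt_one_of_one_lt₀ (NNReal.one_lt_rpow one_lt_two hs0)
  obtain ⟨K, hK, h⟩ := exists_stopping_carleson_const hpq hθ
  refine ⟨K, hK, ?_⟩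
  intro ι X _ _ hι cube lev μ f σ hc hlev hμ hf hM hN
  obtain ⟨h1, h2⟩ := h ι hι (boxMass cube lev μ σ q) (boxPairing cube lev μ σ f)
    (fun F => boxPairing cube lev μ σ (boxTest cube lev μ q F)) (mixedPow σ p f)
    (ne_top_of_le_ne_top ENNReal.one_ne_top hN) hM
    (sum_mul_boxPairing_le hc hlev hμ σ hpq hq2 hf)
    (fun P F _ => (hc.levelBox hlev).sum_setLIntegral_stopChildren_le P F _ _)
    (fun P F _ hPF => by
      subst hs
      exact sum_boxMass_stopChildren_le hc hlev hμ hs0 hs1 (hM F) P hPF)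
  exact ⟨h1, fun P hP => (h2 P hP).trans (mul_le_of_le_one_right' hN)⟩

lemma exists_setLIntegral_carleson_const {q p : ℝ} (hqp : q.HolderConjugate p) :
    ∃ K : ℝ≥0∞, K ≠ ∞ ∧ ∀ (ι X : Type) [PartialOrder ι] [MeasurableSpace X], IsForest ι →
      ∀ (cube : ι → Set X) (g : X → ℝ≥0∞) (ω : Measure X),
      IsNested cube → Measurable g → (∀ F, ω (cube F) ≠ ∞) → ∫⁻ x, g x ^ q ∂ω ≤ 1 →
      (∀ F, (∫⁻ x in cube F, g x ∂ω) / ω (cube F) * ω (cube F) = ∫⁻ x in cube F, g x ∂ω) ∧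
      ∀ P : Finset ι, IsStopFamily (badPair (fun F => ∫⁻ x in cube F, g x ∂ω)
          (fun F => ω (cube F)) fun _ F => ω (cube F)) P →
        ∑ F ∈ P, ((∫⁻ x in cube F, g x ∂ω) / ω (cube F)) ^ q * ω (cube F) ≤ K := by
  have hθ : (2⁻¹ : ℝ≥0) < 1 := inv_lt_one_of_one_lt₀ one_lt_two
  obtain ⟨K, hK, h⟩ := exists_stopping_carleson_const hqp hθ
  refine ⟨K, hK, ?_⟩
  intro ι X _ _ hι cube g ω hc hg hW hN
  obtain ⟨h1, h2⟩ := h ι hι (fun F => ω (cube F)) (fun F => ∫⁻ x in cube F, g x ∂ω)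
    (fun _ F => ω (cube F)) (∫⁻ x, g x ^ q ∂ω)
    (ne_top_of_le_ne_top ENNReal.one_ne_top hN) hW
    (hc.sum_mul_setLIntegral_le ω hqp hg)
    (fun P F _ => hc.sum_setLIntegral_stopChildren_le P F _ _)
    (fun P F _ hPF => by
      rw [ENNReal.coe_inv two_ne_zero, ← ENNReal.div_eq_inv_mul,
        ENNReal.le_div_iff_mul_le (by simp) (by simp), mul_comm]
      simpa using hPF)
  exact ⟨h1, fun P hP => (h2 P hP).trans (mul_le_of_le_one_right' hN)⟩

variable {ι X : Type} [Fintype ι] [PartialOrder ι] [MeasurableSpace X] {cube : ι → Set X}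
  {lev : ι → ℤ} {μ f : X × ℤ → ℝ≥0∞} {g : X → ℝ≥0∞} {σ ω : Measure X} {l : ι → ℝ≥0∞}
  {p q : ℝ} {T K : ℝ≥0∞}

/-- The part of the form where the averages of `f` dominate those of `g`. -/
lemma sum_le_of_boxTest_testing (hι : IsForest ι) (hc : IsNested cube) (hlev : Antitone lev)
    (hμ : Measurable μ) (hg : Measurable g) (hpq : p.HolderConjugate q)
    (hM : ∀ F, boxMass cube lev μ σ q F ≠ ∞) (hg1 : ∫⁻ x, g x ^ q ∂ω ≤ 1)
    (hA : ∀ F, boxPairing cube lev μ σ f F / boxMass cube lev μ σ q F * boxMass cube lev μ σ q F =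
      boxPairing cube lev μ σ f F)
    (hB : ∀ F, (∫⁻ x in cube F, g x ∂ω) / ω (cube F) * ω (cube F) = ∫⁻ x in cube F, g x ∂ω)
    (hK : ∀ P : Finset ι, IsStopFamily
      (badPair (boxPairing cube lev μ σ f) (boxMass cube lev μ σ q)
        fun F => boxPairing cube lev μ σ (boxTest cube lev μ q F)) P →
      ∑ F ∈ P, (boxPairing cube lev μ σ f F / boxMass cube lev μ σ q F) ^ p
        * boxMass cube lev μ σ q F ≤ K)
    (htest : ∀ F, ∀ h : X → ℝ≥0∞, Measurable h →
      ∑ Q with Q ≤ F, l Q * boxPairing cube lev μ σ (boxTest cube lev μ q F) Q *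
        ∫⁻ x in cube Q, h x ∂ω ≤
      T * boxMass cube lev μ σ q F ^ (1 / p) * (∫⁻ x, h x ^ q ∂ω) ^ (1 / q))
    (hdom : ∀ Q, ((∫⁻ x in cube Q, g x ∂ω) / ω (cube Q)) ^ q * ω (cube Q) ≤
      (boxPairing cube lev μ σ f Q / boxMass cube lev μ σ q Q) ^ p * boxMass cube lev μ σ q Q) :
    ∑ Q, l Q * boxPairing cube lev μ σ f Q * ∫⁻ x in cube Q, g x ∂ω ≤
      2 * T * (K + 2 ^ q * (1 + K)) := by
  obtain ⟨P, hP⟩ := exists_isStopFamily (badPair (boxPairing cube lev μ σ f)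
    (boxMass cube lev μ σ q) fun F => boxPairing cube lev μ σ (boxTest cube lev μ q F))
  set B : ι → ℝ≥0∞ := fun G => (∫⁻ x in cube G, g x ∂ω) / ω (cube G)
  refine sum_le_of_stopFamily hpq (P := P) (M := boxMass cube lev μ σ q)
    (β := fun F Q => ∫⁻ x in cube Q, scalarPiece cube P B g F x ∂ω)
    (y := fun F => (∫⁻ x, scalarPiece cube P B g F x ^ q ∂ω) ^ (1 / q)) hP hA
    (fun F => boxPairing_boxTest_self hc hlev hμ hpq.symm.pos (hM F))
    (fun F Q hQ => hc.setLIntegral_le_of_isStopTop hQ ω hg (fun _ => measurable_const)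
      fun G => by rw [lintegral_const, Measure.restrict_apply_univ]; exact hB G)
    (fun F _ => htest F _ (hc.measurable_scalarPiece P B hg F)) (hK P hP) ?_
  calc _ = ∑ F ∈ P, ∫⁻ x, scalarPiece cube P B g F x ^ q ∂ω := by
        refine Finset.sum_congr rfl fun F _ => ?_
        rw [← ENNReal.rpow_mul, one_div, inv_mul_cancel₀ hpq.symm.ne_zero, ENNReal.rpow_one]
    _ ≤ 2 ^ q * (∫⁻ x, g x ^ q ∂ω + ∑ F ∈ P, B F ^ q * ω (cube F)) :=
        hc.sum_lintegral_scalarPiece_rpow_le hι P B hg ω hpq.symm.pos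
    _ ≤ _ := by
        gcongr
        exact (Finset.sum_le_sum fun F _ => hdom F).trans (hK P hP)

/-- The part of the form where the averages of `g` dominate those of `f`. -/
lemma sum_le_of_indicator_testing (hι : IsForest ι) (hc : IsNested cube) (hlev : Antitone lev)
    (hμ : Measurable μ) (hf : Measurable f) (hp : 2 ≤ p) (hpq : p.HolderConjugate q)
    (hM : ∀ F, boxMass cube lev μ σ q F ≠ ∞) (hf1 : mixedPow σ p f ≤ 1)
    (hA : ∀ F, boxPairing cube lev μ σ f F / boxMass cube lev μ σ q F * boxMass cube lev μ σ q F =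
      boxPairing cube lev μ σ f F)
    (hB : ∀ F, (∫⁻ x in cube F, g x ∂ω) / ω (cube F) * ω (cube F) = ∫⁻ x in cube F, g x ∂ω)
    (hK : ∀ P : Finset ι, IsStopFamily (badPair (fun F => ∫⁻ x in cube F, g x ∂ω)
          (fun F => ω (cube F)) fun _ F => ω (cube F)) P →
        ∑ F ∈ P, ((∫⁻ x in cube F, g x ∂ω) / ω (cube F)) ^ q * ω (cube F) ≤ K)
    (htest : ∀ F, ∀ h : X × ℤ → ℝ≥0∞, Measurable h →
      ∑ Q with Q ≤ F, l Q * boxPairing cube lev μ σ h Q * ω (cube Q) ≤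
      T * mixedPow σ p h ^ (1 / p) * ω (cube F) ^ (1 / q))
    (hdom : ∀ Q, (boxPairing cube lev μ σ f Q / boxMass cube lev μ σ q Q) ^ p *
      boxMass cube lev μ σ q Q ≤ ((∫⁻ x in cube Q, g x ∂ω) / ω (cube Q)) ^ q * ω (cube Q)) :
    ∑ Q, l Q * boxPairing cube lev μ σ f Q * ∫⁻ x in cube Q, g x ∂ω ≤
      2 * T * (K + 8 ^ (p / 2) * (1 + K)) := by
  obtain ⟨P, hP⟩ := exists_isStopFamily (badPair (fun F => ∫⁻ x in cube F, g x ∂ω)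
    (fun F => ω (cube F)) fun _ F => ω (cube F))
  set A : ι → ℝ≥0∞ := fun G => boxPairing cube lev μ σ f G / boxMass cube lev μ σ q G
  have htest' : ∀ F, ∀ h : X × ℤ → ℝ≥0∞, Measurable h →
      ∑ Q with Q ≤ F, l Q * ω (cube Q) * boxPairing cube lev μ σ h Q ≤
        T * ω (cube F) ^ (1 / q) * mixedPow σ p h ^ (1 / p) := fun F h hh =>
    le_of_eq_of_le (Finset.sum_congr rfl fun _ _ => mul_right_comm _ _ _)
      ((htest F h hh).trans_eq (mul_right_comm _ _ _))
  refine le_of_eq_of_le (Finset.sum_congr rfl fun _ _ => mul_right_comm _ _ _) ?_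
  refine sum_le_of_stopFamily hpq.symm (P := P) (M := fun F => ω (cube F))
    (β := fun F Q => boxPairing cube lev μ σ (vectorPiece cube lev μ q P A f F) Q)
    (y := fun F => mixedPow σ p (vectorPiece cube lev μ q P A f F) ^ (1 / p)) hP hB
    (fun F => rfl)
    (fun F Q hQ => boxPairing_le_vectorPiece hc hlev hμ hpq.symm.pos hM hf hA hQ)
    (fun F _ => htest' F _ (measurable_vectorPiece hc hlev hμ q P A hf F)) (hK P hP) ?_
  calc _ = ∑ F ∈ P, mixedPow σ p (vectorPiece cube lev μ q P A f F) := by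
        refine Finset.sum_congr rfl fun F _ => ?_
        rw [← ENNReal.rpow_mul, one_div, inv_mul_cancel₀ hpq.ne_zero, ENNReal.rpow_one]
    _ ≤ 8 ^ (p / 2) * (mixedPow σ p f + ∑ F ∈ P, A F ^ p * boxMass cube lev μ σ q F) :=
        sum_mixedPow_vectorPiece_le hι hc hlev hμ hp hpq hM P A hf
    _ ≤ _ := by
        gcongr
        exact (Finset.sum_le_sum fun F _ => hdom F).trans (hK P hP)

end Bilinear

section Combination

lemma sum_subtype_filter_le {ι : Type} [Fintype ι] [PartialOrder ι] {D : ι → Prop}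
    [DecidablePred D]
    (F : {Q // D Q}) (v : ι → ℝ≥0∞) :
    ∑ Q : {Q // D Q} with Q ≤ F, v Q ≤ ∑ Q with Q ≤ F.1, v Q := by
  refine le_of_eq_of_le (Finset.sum_map _ (Function.Embedding.subtype D) v).symm
    (Finset.sum_le_sum_of_subset fun Q hQ => ?_)
  simp only [Finset.mem_map, Finset.mem_filter, Finset.mem_univ, true_and,
    Function.Embedding.subtype_apply] at hQ ⊢
  obtain ⟨R, hR, rfl⟩ := hQ
  exact hR

lemma exists_bilinear_const {p q : ℝ} (hp : 2 ≤ p) (hpq : p.HolderConjugate q) :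
    ∃ C : ℝ≥0∞, C ≠ ∞ ∧ ∀ (ι X : Type) [Fintype ι] [PartialOrder ι] [MeasurableSpace X],
      IsForest ι → ∀ (cube : ι → Set X) (lev : ι → ℤ) (μ f : X × ℤ → ℝ≥0∞) (g : X → ℝ≥0∞)
      (σ ω : Measure X) (l : ι → ℝ≥0∞) (T Tstar : ℝ≥0∞),
      IsNested cube → Antitone lev → Measurable μ → Measurable f → Measurable g →
      (∀ F, boxMass cube lev μ σ q F ≠ ∞) → (∀ F, ω (cube F) ≠ ∞) →
      (∀ F, ∀ h : X → ℝ≥0∞, Measurable h →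
        ∑ Q with Q ≤ F, l Q * boxPairing cube lev μ σ (boxTest cube lev μ q F) Q *
          ∫⁻ x in cube Q, h x ∂ω ≤
        T * boxMass cube lev μ σ q F ^ (1 / p) * (∫⁻ x, h x ^ q ∂ω) ^ (1 / q)) →
      (∀ F, ∀ h : X × ℤ → ℝ≥0∞, Measurable h →
        ∑ Q with Q ≤ F, l Q * boxPairing cube lev μ σ h Q * ω (cube Q) ≤
        Tstar * mixedPow σ p h ^ (1 / p) * ω (cube F) ^ (1 / q)) →
      mixedPow σ p f ≤ 1 → ∫⁻ x, g x ^ q ∂ω ≤ 1 →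
      ∑ Q, l Q * boxPairing cube lev μ σ f Q * ∫⁻ x in cube Q, g x ∂ω ≤ C * (T + Tstar) := by
  obtain ⟨K, hK, hKf⟩ := exists_boxPairing_carleson_const hp hpq
  obtain ⟨L, hL, hLg⟩ := exists_setLIntegral_carleson_const hpq.symm
  set C₁ := 2 * (K + 2 ^ q * (1 + K)) with hC₁
  set C₂ := 2 * (L + 8 ^ (p / 2) * (1 + L)) with hC₂
  have h1 : C₁ ≠ ∞ := by
    have : (2 : ℝ≥0∞) ^ q ≠ ∞ := ENNReal.rpow_ne_top_of_nonneg hpq.symm.pos.le (by simp)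
    finiteness
  have h2 : C₂ ≠ ∞ := by
    have : (8 : ℝ≥0∞) ^ (p / 2) ≠ ∞ := ENNReal.rpow_ne_top_of_nonneg (by positivity) (by simp)
    finiteness
  refine ⟨C₁ + C₂, ENNReal.add_ne_top.2 ⟨h1, h2⟩, ?_⟩
  intro ι X _ _ _ hι cube lev μ f g σ ω l T Tstar hc hlev hμ hf hg hM hW hT hTstar hf1 hg1
  have hιD : ∀ D : ι → Prop, IsForest {Q // D Q} := fun D Q R S hR hS => hι Q R S hR hS
  have hcD : ∀ D : ι → Prop, IsNested fun Q : {Q // D Q} => cube Q := fun D =>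
    ⟨fun Q => hc.measurableSet Q, fun h => hc.mono h, fun h h' => hc.comparable h h'⟩
  have hlevD : ∀ D : ι → Prop, Antitone fun Q : {Q // D Q} => lev Q := fun D _ _ h => hlev h
  set D : ι → Prop := fun Q => ((∫⁻ x in cube Q, g x ∂ω) / ω (cube Q)) ^ q * ω (cube Q) ≤
      (boxPairing cube lev μ σ f Q / boxMass cube lev μ σ q Q) ^ p * boxMass cube lev μ σ q Q
  have hA := (hKf ι X hι cube lev μ f σ hc hlev hμ hf hM hf1).1
  have hB := (hLg ι X hι cube g ω hc hg hW hg1).1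
  have hfirst : ∑ Q : {Q // D Q}, l Q * boxPairing cube lev μ σ f Q * ∫⁻ x in cube Q, g x ∂ω ≤
      2 * T * (K + 2 ^ q * (1 + K)) :=
    sum_le_of_boxTest_testing (ι := {Q // D Q}) (cube := fun Q => cube Q) (lev := fun Q => lev Q)
      (l := fun Q => l Q) (hιD D) (hcD D) (hlevD D) hμ hg hpq (fun F => hM F) hg1
      (fun F => hA F) (fun F => hB F)
      (hKf _ X (hιD D) _ _ μ f σ (hcD D) (hlevD D) hμ hf (fun F => hM F) hf1).2
      (fun F h hh => (sum_subtype_filter_le F _).trans (hT F h hh)) fun Q => Q.2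
  have hsecond : ∑ Q : {Q // ¬ D Q}, l Q * boxPairing cube lev μ σ f Q *
      ∫⁻ x in cube Q, g x ∂ω ≤ 2 * Tstar * (L + 8 ^ (p / 2) * (1 + L)) :=
    sum_le_of_indicator_testing (ι := {Q // ¬ D Q}) (cube := fun Q => cube Q)
      (lev := fun Q => lev Q) (l := fun Q => l Q) (hιD _) (hcD _) (hlevD _) hμ hf hp hpq
      (fun F => hM F) hf1 (fun F => hA F) (fun F => hB F)
      (hLg _ X (hιD _) _ g ω (hcD _) hg (fun F => hW F) hg1).2
      (fun F h hh => (sum_subtype_filter_le F _).trans (hTstar F h hh))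
      fun Q => (not_le.1 Q.2).le
  rw [← Fintype.sum_subtype_add_sum_subtype D]
  calc _ ≤ 2 * T * (K + 2 ^ q * (1 + K)) + 2 * Tstar * (L + 8 ^ (p / 2) * (1 + L)) :=
        add_le_add hfirst hsecond
    _ = C₁ * T + C₂ * Tstar := by rw [hC₁, hC₂]; ring
    _ ≤ (C₁ + C₂) * T + (C₁ + C₂) * Tstar := by
        gcongr
        · exact le_self_add
        · exact le_add_self
    _ = _ := by ring

end Combination

section DyadicCubes

variable {n : ℕ}

lemma mem_idxCube_iff {Q : CubeIdx n} {x : Fin n → ℝ} :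
    x ∈ idxCube n Q ↔ ∀ i, ⌊(2 : ℝ) ^ Q.1 * x i⌋ = Q.2 i := by
  refine forall_congr' fun i => ?_
  have h2 : (0 : ℝ) < 2 ^ Q.1 := by positivity
  rw [Int.floor_eq_iff, Set.mem_Ico, zpow_neg, inv_mul_le_iff₀ h2, lt_inv_mul_iff₀ h2]

lemma nonempty_idxCube (Q : CubeIdx n) : (idxCube n Q).Nonempty := by
  refine ⟨fun i => (2 : ℝ) ^ (-Q.1) * Q.2 i, mem_idxCube_iff.2 fun i => ?_⟩
  rw [zpow_neg, mul_inv_cancel_left₀ (by positivity), Int.floor_intCast]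

lemma measurableSet_idxCube (Q : CubeIdx n) : MeasurableSet (idxCube n Q) := by
  have : idxCube n Q = Set.univ.pi fun i =>
      Set.Ico ((2 : ℝ) ^ (-Q.1) * Q.2 i) ((2 : ℝ) ^ (-Q.1) * (Q.2 i + 1)) := by
    ext x; simp [idxCube, dyadicCube]
  rw [this]
  exact MeasurableSet.univ_pi fun i => measurableSet_Ico

lemma measure_idxCube_ne_top (ω : Measure (Fin n → ℝ)) [IsLocallyFiniteMeasure ω]
    (Q : CubeIdx n) : ω (idxCube n Q) ≠ ∞ := by
  refine ((measure_mono fun x hx => ?_).trans_lt (isCompact_Icc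
    (a := fun i => (2 : ℝ) ^ (-Q.1) * Q.2 i)
    (b := fun i => (2 : ℝ) ^ (-Q.1) * (Q.2 i + 1))).measure_lt_top).ne
  exact ⟨fun i => (hx i).1, fun i => (hx i).2.le⟩

lemma floor_two_zpow_mul {k k' : ℤ} (h : k' ≤ k) (t : ℝ) :
    ⌊(2 : ℝ) ^ k' * t⌋ = ⌊(2 : ℝ) ^ k * t⌋ / ((2 ^ (k - k').toNat : ℕ) : ℤ) := by
  rw [← Int.floor_div_natCast]
  congr 1
  have h' : ((2 ^ (k - k').toNat : ℕ) : ℝ) = 2 ^ (k - k') := by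
    push_cast
    rw [← zpow_natCast, Int.toNat_of_nonneg (by omega)]
  rw [h', zpow_sub₀ two_ne_zero]
  field_simp

lemma idxCube_subset_of_mem {Q R : CubeIdx n} {x : Fin n → ℝ} (hQ : x ∈ idxCube n Q)
    (hR : x ∈ idxCube n R) (h : R.1 ≤ Q.1) : idxCube n Q ⊆ idxCube n R := by
  intro y hy
  rw [mem_idxCube_iff] at *
  intro i
  rw [← hR i, floor_two_zpow_mul h, floor_two_zpow_mul h, hy, hQ]

lemma fst_le_of_idxCube_subset (hn : 0 < n) {Q R : CubeIdx n} (h : idxCube n Q ⊆ idxCube n R) :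
    R.1 ≤ Q.1 := by
  by_contra! hlt
  have mem : ∀ s : ℝ, 0 ≤ s → s < 1 →
      (fun i => (2 : ℝ) ^ (-Q.1) * (Q.2 i + s)) ∈ idxCube n Q := fun s h0 h1 i =>
    ⟨by simp only; gcongr; linarith, by simp only; gcongr⟩
  have h0 := (h (mem 0 le_rfl one_pos) ⟨0, hn⟩).1
  have h1 := (h (mem (1 / 2) (by norm_num) (by norm_num)) ⟨0, hn⟩).2
  have hpow : (2 : ℝ) ^ (-R.1) ≤ 2 ^ (-Q.1) * (1 / 2) := by
    have : (2 : ℝ) ^ (-Q.1) * (1 / 2) = 2 ^ (-Q.1 - 1) := by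
      rw [zpow_sub_one₀ two_ne_zero]; ring
    rw [this]
    exact zpow_le_zpow_right₀ one_le_two (by omega)
  linarith

lemma idxCube_injective (hn : 0 < n) : Function.Injective (idxCube n) := by
  intro Q R h
  have hk : Q.1 = R.1 := le_antisymm (fst_le_of_idxCube_subset hn h.ge)
    (fst_le_of_idxCube_subset hn h.le)
  obtain ⟨x, hx⟩ := nonempty_idxCube Q
  have hx' : x ∈ idxCube n R := h ▸ hx
  rw [mem_idxCube_iff] at hx hx'
  refine Prod.ext hk (funext fun i => ?_)
  rw [← hx i, ← hx' i, hk]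

lemma idxCube_subset_or_subset {Q R : CubeIdx n} {x : Fin n → ℝ} (hQ : x ∈ idxCube n Q)
    (hR : x ∈ idxCube n R) : idxCube n Q ⊆ idxCube n R ∨ idxCube n R ⊆ idxCube n Q :=
  (le_total R.1 Q.1).imp (idxCube_subset_of_mem hQ hR) (idxCube_subset_of_mem hR hQ)

end DyadicCubes

section Discretization

variable {n : ℕ}

/-- The sequence `f_k(x) = f(x, 2^{-k})`. -/
def toSeq {X : Type} (f : X × ℝ → ℝ≥0∞) (z : X × ℤ) : ℝ≥0∞ := f (z.1, (2 : ℝ) ^ (-z.2))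

/-- A function whose associated sequence is `h`. -/
def ofSeq {X : Type} (h : X × ℤ → ℝ≥0∞) (z : X × ℝ) : ℝ≥0∞ := h (z.1, -⌊Real.logb 2 z.2⌋)

lemma toSeq_ofSeq {X : Type} (h : X × ℤ → ℝ≥0∞) : toSeq (ofSeq h) = h := by
  ext z
  have : Real.logb 2 ((2 : ℝ) ^ (-z.2)) = ((-z.2 : ℤ) : ℝ) := by
    rw [← Real.rpow_intCast, Real.logb_rpow two_pos (by norm_num)]
  simp only [toSeq, ofSeq, this, Int.floor_intCast, neg_neg]

lemma measurable_toSeq {X : Type} [MeasurableSpace X] {f : X × ℝ → ℝ≥0∞} (hf : Measurable f) :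
    Measurable (toSeq f) :=
  hf.comp (measurable_fst.prodMk
    ((measurable_from_top (f := fun k : ℤ => (2 : ℝ) ^ (-k))).comp measurable_snd))

lemma measurable_ofSeq {X : Type} [MeasurableSpace X] {h : X × ℤ → ℝ≥0∞} (hh : Measurable h) :
    Measurable (ofSeq h) := by
  have : Measurable fun t : ℝ => -⌊Real.logb 2 t⌋ :=
    ((Real.measurable_log.div_const _).floor).neg
  exact hh.comp (measurable_fst.prodMk (this.comp measurable_snd))

lemma mixedNorm_eq (σ : Measure (Fin n → ℝ)) (r : ℝ) (f : (Fin n → ℝ) × ℝ → ℝ≥0∞) :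
    mixedNorm n σ r f = mixedPow σ r (toSeq f) ^ (1 / r) := by
  unfold mixedNorm mixedPow
  congr 1
  refine lintegral_congr fun x => ?_
  rw [vertL2, ← ENNReal.rpow_mul, one_div_mul_eq_div]
  rfl

lemma toSeq_boxFn (μ : (Fin n → ℝ) × ℝ → ℝ≥0∞) (Q : CubeIdx n) :
    toSeq (boxFn n μ Q.1 Q.2) = (levelBox (idxCube n) Prod.fst Q).indicator (toSeq μ) := by
  ext z
  have hiff : (z.1, (2 : ℝ) ^ (-z.2)) ∈ carlesonBox n Q.1 Q.2 ↔
      z ∈ levelBox (idxCube n) Prod.fst Q := by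
    have h2 : (0 : ℝ) < 2 ^ (-z.2) := by positivity
    have h3 : (2 : ℝ) ^ (-z.2) ≤ 2 ^ (-Q.1) ↔ Q.1 ≤ z.2 := by
      rw [zpow_le_zpow_iff_right₀ (_root_.one_lt_two), neg_le_neg_iff]
    simp only [carlesonBox, levelBox, Set.mem_prod, Set.mem_Ioc, Set.mem_Ici, h2, h3, true_and]
    rfl
  by_cases hz : z ∈ levelBox (idxCube n) Prod.fst Q
  · rw [Set.indicator_of_mem hz, toSeq, boxFn, Set.indicator_of_mem (hiff.2 hz)]
    rfl
  · rw [Set.indicator_of_notMem hz, toSeq, boxFn, Set.indicator_of_notMem (hz ∘ hiff.1)]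

lemma vertL2_boxFn (μ : (Fin n → ℝ) × ℝ → ℝ≥0∞) (Q : CubeIdx n) (x : Fin n → ℝ) :
    vertL2 n (boxFn n μ Q.1 Q.2) x = boxSq (idxCube n) Prod.fst (toSeq μ) Q x ^ (1 / 2 : ℝ) := by
  rw [boxSq, ← toSeq_boxFn]
  rfl

lemma toSeq_testFn (q : ℝ) (μ : (Fin n → ℝ) × ℝ → ℝ≥0∞) (Q : CubeIdx n) :
    toSeq (testFn n q μ Q.1 Q.2) = boxTest (idxCube n) Prod.fst (toSeq μ) q Q := by
  ext z
  have hz : boxFn n μ Q.1 Q.2 (z.1, (2 : ℝ) ^ (-z.2)) =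
    (levelBox (idxCube n) Prod.fst Q).indicator (toSeq μ) z := congrFun (toSeq_boxFn μ Q) z
  simp only [toSeq, testFn, boxTest, vertL2_boxFn, hz]
  have e : (1 / 2 : ℝ) * (q - 2) = q / 2 - 1 := by ring
  rw [← ENNReal.rpow_mul, e]
  split_ifs with h0
  · have h0' : boxSq (idxCube n) Prod.fst (toSeq μ) Q z.1 = 0 := by
      exact (ENNReal.rpow_eq_zero_iff_of_pos (by norm_num)).1 h0
    rw [boxSq, sqSum, ENNReal.tsum_eq_zero] at h0'
    have := h0' z.2
    rw [sq_eq_zero_iff] at this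
    rw [show z = (z.1, z.2) from rfl, this, mul_zero]
  · rfl

lemma boxInt_eq (σ : Measure (Fin n → ℝ)) {μ f : (Fin n → ℝ) × ℝ → ℝ≥0∞}
    (hμ : Measurable μ) (hf : Measurable f) (Q : CubeIdx n) :
    boxInt n σ μ f Q.1 Q.2 =
      boxPairing (idxCube n) Prod.fst (toSeq μ) σ (toSeq f) Q := by
  have hm := (measurable_toSeq hf).fun_mul (measurable_toSeq hμ)
  have hS : MeasurableSet (levelBox (idxCube n) Prod.fst Q) :=
    (measurableSet_idxCube Q).prod measurableSet_Ici
  have hmk : ∀ k : ℤ, Measurable fun x => (levelBox (idxCube n) Prod.fst Q).indicator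
      (fun z => toSeq f z * toSeq μ z) (x, k) := fun k =>
    (hm.indicator hS).comp measurable_prodMk_right
  rw [boxPairing, ← lintegral_indicator hS, lintegral_prod_count σ (hm.indicator hS),
    lintegral_tsum fun k => (hmk k).aemeasurable, boxInt, ← (Equiv.neg ℤ).tsum_eq]
  refine tsum_congr fun k => ?_
  have h3 : (2 : ℝ) ^ (Equiv.neg ℤ k) ≤ 2 ^ (-Q.1) ↔ Q.1 ≤ k := by
    rw [Equiv.neg_apply, zpow_le_zpow_iff_right₀ (_root_.one_lt_two), neg_le_neg_iff]
  split_ifs with hk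
  · rw [h3] at hk
    change ∫⁻ x in idxCube n Q, _ ∂σ = _
    rw [← lintegral_indicator (measurableSet_idxCube Q)]
    refine lintegral_congr fun x => ?_
    by_cases hx : x ∈ idxCube n Q <;> simp [levelBox, hx, hk, toSeq]
  · rw [h3] at hk
    simp [levelBox, hk]

end Discretization

section Form

variable {n : ℕ}

/-- A finite family of dyadic cubes, to be ordered by inclusion. -/
def CubeFamily (S : Finset (CubeIdx n)) : Type := {Q // Q ∈ S}

instance (S : Finset (CubeIdx n)) : Fintype (CubeFamily S) := inferInstanceAs (Fintype {Q // Q ∈ S})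

lemma sum_cubeFamily (S : Finset (CubeIdx n)) (v : CubeIdx n → ℝ≥0∞) :
    ∑ Q : CubeFamily S, v Q.1 = ∑ Q ∈ S, v Q :=
  Finset.sum_coe_sort S v

lemma measurable_testFn (q : ℝ) {μ : (Fin n → ℝ) × ℝ → ℝ≥0∞} (hμ : Measurable μ)
    (Q : CubeIdx n) : Measurable (testFn n q μ Q.1 Q.2) := by
  have hb : Measurable (boxFn n μ Q.1 Q.2) :=
    hμ.indicator ((measurableSet_idxCube Q).prod measurableSet_Ioc)
  have hv : Measurable fun z : (Fin n → ℝ) × ℝ => vertL2 n (boxFn n μ Q.1 Q.2) z.1 :=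
    ((measurable_sqSum (measurable_toSeq hb)).pow_const _).comp measurable_fst
  exact Measurable.ite (hv (measurableSet_singleton 0)) measurable_const
    ((hv.pow_const _).mul hb)

lemma sum_cubeFamily_le_lambdaLoc (σ ω : Measure (Fin n → ℝ)) (μ f : (Fin n → ℝ) × ℝ → ℝ≥0∞)
    (lam : CubeIdx n → ℝ≥0) (g : (Fin n → ℝ) → ℝ≥0∞) (S : Finset (CubeIdx n)) (F : CubeIdx n) :
    ∑ Q : CubeFamily S with idxCube n Q.1 ⊆ idxCube n F,
      (lam Q.1 : ℝ≥0∞) * boxInt n σ μ f Q.1.1 Q.1.2 * ∫⁻ x in idxCube n Q.1, g x ∂ω ≤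
      lambdaLoc n σ ω μ lam F f g := by
  rw [Finset.sum_filter, sum_cubeFamily S fun Q => if idxCube n Q ⊆ idxCube n F then
    (lam Q : ℝ≥0∞) * boxInt n σ μ f Q.1 Q.2 * ∫⁻ x in idxCube n Q, g x ∂ω else 0]
  exact ENNReal.sum_le_tsum S

lemma rpow_one_div_le_one_iff {x : ℝ≥0∞} {r : ℝ} (hr : 0 < r) : x ^ (1 / r) ≤ 1 ↔ x ≤ 1 := by
  rw [one_div, ENNReal.rpow_inv_le_iff hr, ENNReal.one_rpow]

lemma exists_lambdaForm_const {p q : ℝ} (hp : 2 ≤ p) (hpq : p.HolderConjugate q) :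
    ∃ C : ℝ≥0∞, C ≠ ∞ ∧ ∀ (n : ℕ), 0 < n → ∀ (σ ω : Measure (Fin n → ℝ))
      [IsLocallyFiniteMeasure ω] (μ : (Fin n → ℝ) × ℝ → ℝ≥0∞), Measurable μ →
      (∀ Q : CubeIdx n, mixedNorm n σ q (boxFn n μ Q.1 Q.2) < ∞) →
      ∀ (lam : CubeIdx n → ℝ≥0) (T Tstar : ℝ≥0∞),
      (∀ (Q : CubeIdx n) (g : (Fin n → ℝ) → ℝ≥0∞), Measurable g →
        lambdaLoc n σ ω μ lam Q (testFn n q μ Q.1 Q.2) g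
          ≤ T * mixedNorm n σ p (testFn n q μ Q.1 Q.2) * lpNorm n ω q g) →
      (∀ (Q : CubeIdx n) (f : (Fin n → ℝ) × ℝ → ℝ≥0∞), Measurable f →
        lambdaLoc n σ ω μ lam Q f ((idxCube n Q).indicator 1)
          ≤ Tstar * mixedNorm n σ p f * (ω (idxCube n Q)) ^ (1 / q)) →
      ∀ (f : (Fin n → ℝ) × ℝ → ℝ≥0∞) (g : (Fin n → ℝ) → ℝ≥0∞), Measurable f → Measurable g →
      mixedNorm n σ p f ≤ 1 → lpNorm n ω q g ≤ 1 →
      lambdaForm n σ ω μ lam f g ≤ C * (T + Tstar) := by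
  obtain ⟨C, hC, h⟩ := exists_bilinear_const hp hpq
  have hp0 := hpq.pos
  have hq0 := hpq.symm.pos
  refine ⟨C, hC, ?_⟩
  intro n hn σ ω _ μ hμ hfin lam T Tstar hT hTstar f g hf hg hf1 hg1
  rw [lambdaForm, ENNReal.tsum_eq_iSup_sum]
  refine iSup_le fun S => ?_
  let _ : PartialOrder (CubeFamily S) := PartialOrder.lift (fun Q : CubeFamily S => idxCube n Q.1)
    ((idxCube_injective hn).comp Subtype.val_injective)
  have hforest : IsForest (CubeFamily S) := by
    intro Q R R' hR hR'
    obtain ⟨x, hx⟩ := nonempty_idxCube Q.1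
    exact idxCube_subset_or_subset (hR hx) (hR' hx)
  have hc : IsNested fun Q : CubeFamily S => idxCube n Q.1 :=
    ⟨fun Q => measurableSet_idxCube Q.1, fun h => h, fun h h' => idxCube_subset_or_subset h h'⟩
  have hlev : Antitone fun Q : CubeFamily S => Q.1.1 := fun Q R hQR => fst_le_of_idxCube_subset hn hQR
  have hμ' := measurable_toSeq hμ
  have hM : ∀ Q : CubeIdx n, boxMass (idxCube n) Prod.fst (toSeq μ) σ q Q ≠ ∞ := by
    intro Q htop
    have h := hfin Q
    rw [mixedNorm_eq, toSeq_boxFn] at h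
    have e : mixedPow σ q ((levelBox (idxCube n) Prod.fst Q).indicator (toSeq μ)) = ∞ := htop
    rw [e, ENNReal.top_rpow_of_pos (by positivity)] at h
    exact lt_irrefl _ h
  have key := h (CubeFamily S) (Fin n → ℝ) hforest (fun Q => idxCube n Q.1) (fun Q => Q.1.1) (toSeq μ) (toSeq f)
    g σ ω (fun Q => lam Q.1) T Tstar hc hlev hμ' (measurable_toSeq hf) hg (fun F => hM F.1)
    (fun F => measure_idxCube_ne_top ω F.1) ?_ ?_
    ((rpow_one_div_le_one_iff hp0).1 (mixedNorm_eq σ p f ▸ hf1))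
    ((rpow_one_div_le_one_iff hq0).1 hg1)
  · refine le_trans (le_of_eq ?_) key
    rw [← sum_cubeFamily]
    refine Finset.sum_congr rfl fun Q _ => ?_
    rw [boxInt_eq σ hμ hf Q.1]
    rfl
  · intro F k hk
    have e : mixedPow σ p (boxTest (idxCube n) Prod.fst (toSeq μ) q F.1) =
        boxMass (idxCube n) Prod.fst (toSeq μ) σ q F.1 :=
      mixedPow_boxTest (cube := fun Q : CubeFamily S => idxCube n Q.1) hc hlev hμ' hpq (hM F.1)
    have hF := hT F.1 k hk
    rw [mixedNorm_eq, toSeq_testFn, e] at hF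
    refine le_trans (le_of_eq ?_) ((sum_cubeFamily_le_lambdaLoc σ ω μ _ lam k S F.1).trans hF)
    refine Finset.sum_congr rfl fun Q _ => ?_
    rw [boxInt_eq σ hμ (measurable_testFn q hμ F.1) Q.1, toSeq_testFn]
    rfl
  · intro F k hk
    have hF := hTstar F.1 (ofSeq k) (measurable_ofSeq hk)
    rw [mixedNorm_eq, toSeq_ofSeq] at hF
    refine le_trans (le_of_eq ?_) ((sum_cubeFamily_le_lambdaLoc σ ω μ (ofSeq k) lam _ S F.1).trans hF)
    refine Finset.sum_congr rfl fun Q hQ => ?_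
    have hQF : idxCube n Q.1 ⊆ idxCube n F.1 := (Finset.mem_filter.1 hQ).2
    rw [boxInt_eq σ hμ (measurable_ofSeq hk) Q.1, toSeq_ofSeq,
      lintegral_indicator_one (measurableSet_idxCube _),
      Measure.restrict_apply (measurableSet_idxCube _), Set.inter_eq_self_of_subset_right hQF]
    rfl

end Form

section Homogeneity

variable {n : ℕ} {σ ω : Measure (Fin n → ℝ)} {μ f : (Fin n → ℝ) × ℝ → ℝ≥0∞}
  {g : (Fin n → ℝ) → ℝ≥0∞} {lam : CubeIdx n → ℝ≥0}

lemma mixedNorm_const_mul {r : ℝ} (hr : 0 < r) (c : ℝ≥0∞) (hf : Measurable f) :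
    mixedNorm n σ r (fun z => c * f z) = c * mixedNorm n σ r f := by
  have hsq : ∀ x, sqSum (toSeq fun z => c * f z) x = c ^ 2 * sqSum (toSeq f) x := fun x => by
    simp only [sqSum, toSeq, mul_pow, ENNReal.tsum_mul_left]
  have e : 2 * (r / 2 * (1 / r)) = 1 := by field_simp
  rw [mixedNorm_eq, mixedNorm_eq, mixedPow, mixedPow]
  simp only [hsq, ENNReal.mul_rpow_of_nonneg _ _ (half_pos hr).le]
  rw [lintegral_const_mul _ ((measurable_sqSum (measurable_toSeq hf)).pow_const _),
    ENNReal.mul_rpow_of_nonneg _ _ (by positivity), ← ENNReal.rpow_two, ← ENNReal.rpow_mul,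
    ← ENNReal.rpow_mul, e, ENNReal.rpow_one]

lemma lpNorm_const_mul {r : ℝ} (hr : 0 < r) (c : ℝ≥0∞) (hg : Measurable g) :
    lpNorm n ω r (fun x => c * g x) = c * lpNorm n ω r g := by
  simp only [_root_.lpNorm, ENNReal.mul_rpow_of_nonneg _ _ hr.le]
  rw [lintegral_const_mul _ (hg.pow_const _), ENNReal.mul_rpow_of_nonneg _ _ (by positivity),
    ← ENNReal.rpow_mul, mul_one_div_cancel hr.ne', ENNReal.rpow_one]

lemma lambdaForm_const_mul (hμ : Measurable μ) (hf : Measurable f) (hg : Measurable g)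
    (c d : ℝ≥0∞) :
    lambdaForm n σ ω μ lam (fun z => c * f z) (fun x => d * g x) =
      c * d * lambdaForm n σ ω μ lam f g := by
  rw [lambdaForm, lambdaForm, ← ENNReal.tsum_mul_left]
  refine tsum_congr fun Q => ?_
  have h : boxPairing (idxCube n) Prod.fst (toSeq μ) σ (toSeq fun z => c * f z) Q =
      c * boxPairing (idxCube n) Prod.fst (toSeq μ) σ (toSeq f) Q := by
    rw [boxPairing, boxPairing,
      ← lintegral_const_mul _ ((measurable_toSeq hf).fun_mul (measurable_toSeq hμ))]
    exact lintegral_congr fun z => mul_assoc _ _ _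
  rw [boxInt_eq σ hμ (hf.const_mul c), boxInt_eq σ hμ hf, h, lintegral_const_mul _ hg]
  ring

lemma lambdaForm_eq_zero_of_mixedNorm {p : ℝ} (hp : 1 < p) (hμ : Measurable μ)
    (hf : Measurable f) (h0 : mixedNorm n σ p f = 0) : lambdaForm n σ ω μ lam f g = 0 := by
  refine ENNReal.tsum_eq_zero.2 fun Q => ?_
  have hS : MeasurableSet (levelBox (idxCube n) Prod.fst Q) :=
    (measurableSet_idxCube Q).prod measurableSet_Ici
  have h := lintegral_mul_le_mixedPow (Real.HolderConjugate.conjExponent hp) σ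
    (measurable_toSeq hf) ((measurable_toSeq hμ).indicator hS)
  rw [← mixedNorm_eq, h0, zero_mul, nonpos_iff_eq_zero] at h
  have : boxPairing (idxCube n) Prod.fst (toSeq μ) σ (toSeq f) Q = 0 := by
    rw [boxPairing, ← lintegral_indicator hS, ← h]
    refine lintegral_congr fun z => ?_
    by_cases hz : z ∈ levelBox (idxCube n) Prod.fst Q <;> simp [hz]
  rw [boxInt_eq σ hμ hf, this, mul_zero, zero_mul]

lemma lambdaForm_eq_zero_of_lpNorm {q : ℝ} (hq : 0 < q) (hg : Measurable g)
    (h0 : lpNorm n ω q g = 0) : lambdaForm n σ ω μ lam f g = 0 := by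
  refine ENNReal.tsum_eq_zero.2 fun Q => ?_
  have h : ∫⁻ x, g x ^ q ∂ω = 0 :=
    (ENNReal.rpow_eq_zero_iff_of_pos (by positivity)).1 h0
  rw [lintegral_eq_zero_iff (hg.pow_const _)] at h
  have hg0 : g =ᵐ[ω] 0 := h.mono fun x hx => (ENNReal.rpow_eq_zero_iff_of_pos hq).1 hx
  have : ∫⁻ x in idxCube n Q, g x ∂ω = 0 := by
    rw [lintegral_congr_ae (ae_restrict_of_ae hg0)]
    simp
  rw [this, mul_zero]

lemma lambdaForm_eq_zero_of_lambdaLoc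
    (h : ∀ Q, lambdaLoc n σ ω μ lam Q f ((idxCube n Q).indicator 1) = 0) :
    lambdaForm n σ ω μ lam f g = 0 := by
  refine ENNReal.tsum_eq_zero.2 fun Q => ?_
  have hQ := ENNReal.tsum_eq_zero.1 (h Q) Q
  rw [if_pos subset_rfl, lintegral_indicator_one (measurableSet_idxCube Q),
    Measure.restrict_apply (measurableSet_idxCube Q), Set.inter_self, mul_eq_zero] at hQ
  rcases hQ with hQ | hQ
  · rw [hQ, zero_mul]
  · rw [setLIntegral_measure_zero _ _ hQ, mul_zero]

end Homogeneity

/-- The main direction of Theorem 1.1: for `p ∈ [2,∞)`, the testing conditions with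
test functions `φ_Q` and indicators `1_Q` imply boundedness of the bilinear form,
with constant `C_p (𝒯 + 𝒯*)` where `C_p` depends only on `p`. -/
theorem statement1 :
    ∀ p : ℝ, 2 ≤ p → ∃ C : ℝ≥0∞, C < ∞ ∧
    ∀ (n : ℕ), 0 < n →
    ∀ (σ ω : Measure (Fin n → ℝ)),
      IsLocallyFiniteMeasure σ → IsLocallyFiniteMeasure ω →
    ∀ (μ : (Fin n → ℝ) × ℝ → ℝ≥0∞), Measurable μ →
    (∀ Q : CubeIdx n, mixedNorm n σ (p/(p-1)) (boxFn n μ Q.1 Q.2) < ∞) →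
    ∀ lam : CubeIdx n → ℝ≥0, ∀ T Tstar : ℝ≥0∞, T < ∞ → Tstar < ∞ →
    (∀ (Q : CubeIdx n) (g : (Fin n → ℝ) → ℝ≥0∞), Measurable g →
        lambdaLoc n σ ω μ lam Q (testFn n (p/(p-1)) μ Q.1 Q.2) g
          ≤ T * mixedNorm n σ p (testFn n (p/(p-1)) μ Q.1 Q.2) * lpNorm n ω (p/(p-1)) g) →
    (∀ (Q : CubeIdx n) (f : (Fin n → ℝ) × ℝ → ℝ≥0∞), Measurable f →
        lambdaLoc n σ ω μ lam Q f ((idxCube n Q).indicator 1)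
          ≤ Tstar * mixedNorm n σ p f * (ω (idxCube n Q)) ^ (1/(p/(p-1)))) →
    ∀ (f : (Fin n → ℝ) × ℝ → ℝ≥0∞) (g : (Fin n → ℝ) → ℝ≥0∞),
      Measurable f → Measurable g →
      lambdaForm n σ ω μ lam f g
        ≤ C * (T + Tstar) * mixedNorm n σ p f * lpNorm n ω (p/(p-1)) g := by
  intro p hp
  have hp1 : 1 < p := by linarith
  have hpq : p.HolderConjugate (p / (p - 1)) := Real.HolderConjugate.conjExponent hp1
  obtain ⟨C, hC, h⟩ := exists_lambdaForm_const hp hpq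
  refine ⟨C + 1, ENNReal.add_lt_top.2 ⟨hC.lt_top, ENNReal.one_lt_top⟩, ?_⟩
  intro n hn σ ω _ _ μ hμ hfin lam T Tstar _ _ hT hTstar f g hf hg
  set q := p / (p - 1)
  set a := mixedNorm n σ p f with ha
  set b := lpNorm n ω q g with hb
  rcases eq_or_ne a 0 with ha0 | ha0
  · rw [lambdaForm_eq_zero_of_mixedNorm hp1 hμ hf ha0]
    exact zero_le
  rcases eq_or_ne b 0 with hb0 | hb0
  · rw [lambdaForm_eq_zero_of_lpNorm hpq.symm.pos hg hb0]
    exact zero_le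
  rcases eq_or_ne (T + Tstar) 0 with hT0 | hT0
  · rw [lambdaForm_eq_zero_of_lambdaLoc fun Q => ?_]
    · exact zero_le
    · simpa [(add_eq_zero.1 hT0).2] using hTstar Q f hf
  have hC0 : (C + 1) * (T + Tstar) ≠ 0 := mul_ne_zero (by simp) hT0
  rcases eq_or_ne a ∞ with hat | hat
  · rw [hat, ENNReal.mul_top hC0, ENNReal.top_mul hb0]
    exact le_top
  rcases eq_or_ne b ∞ with hbt | hbt
  · rw [hbt, ENNReal.mul_top (mul_ne_zero hC0 ha0)]
    exact le_top
  have hscale := h n hn σ ω μ hμ hfin lam T Tstar hT hTstar (fun z => a⁻¹ * f z)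
    (fun x => b⁻¹ * g x) (hf.const_mul _) (hg.const_mul _)
    (by rw [mixedNorm_const_mul hpq.pos _ hf, ← ha, ENNReal.inv_mul_cancel ha0 hat])
    (by rw [lpNorm_const_mul hpq.symm.pos _ hg, ← hb, ENNReal.inv_mul_cancel hb0 hbt])
  rw [lambdaForm_const_mul hμ hf hg] at hscale
  calc lambdaForm n σ ω μ lam f g
      = (a⁻¹ * a) * (b⁻¹ * b) * lambdaForm n σ ω μ lam f g := by
        rw [ENNReal.inv_mul_cancel ha0 hat, ENNReal.inv_mul_cancel hb0 hbt, one_mul, one_mul]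
    _ = a * b * (a⁻¹ * b⁻¹ * lambdaForm n σ ω μ lam f g) := by ring
    _ ≤ a * b * (C * (T + Tstar)) := by gcongr
    _ ≤ a * b * ((C + 1) * (T + Tstar)) := by
        gcongr
        exact le_self_add
    _ = _ := by ring

end
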